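/- arXiv:2510.16151 — 14 statements merged into one kernel-verified Lean document; each statement's English description precedes it below -/
import Mathlib

section
/- Let G be a connected δ-regular graph on n vertices with adjacency matrix A and adjacency eigenvalues λ_1 ≥ λ_2 ≥ ⋯ ≥ λ_n listed with multiplicity (so λ_1 = δ). Let k ≥ 1 and let p be a real polynomial of degree at most k. Set W(p) = max_{u ∈ V} (p(A))_{uu} and λ(p) = min_{2 ≤ i ≤ n} p(λ_i), and assume p(λ_1) > λ(p). Then the k-independence number satisfies α_k(G) ≤ n · (W(p) − λ(p)) / (p(λ_1) − λ(p)). -/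
open Polynomial

/-- The independence number of a simple graph: the maximum size of a set of
pairwise nonadjacent vertices. -/
noncomputable def indepNum {V : Type*} [Fintype V] (G : SimpleGraph V) : ℕ :=
  sSup {n : ℕ | ∃ s : Finset V, s.card = n ∧ ∀ u ∈ s, ∀ v ∈ s, u ≠ v → ¬ G.Adj u v}

/-- The `k`-th power of a graph: two distinct vertices are adjacent iff their
distance in `G` is at most `k`. -/
def graphPower {V : Type*} (G : SimpleGraph V) (k : ℕ) : SimpleGraph V :=
  SimpleGraph.fromRel fun u v => G.dist u v ≤ k

open Matrix in
lemma aux_psd {V : Type*} [Fintype V] [DecidableEq V] (A : Matrix V V ℝ) (hA : A.IsHermitian)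
    (q : ℝ[X]) (hq : ∀ i, 0 ≤ q.eval (hA.eigenvalues i)) : (aeval A q).PosSemidef := by
  have h1 : aeval A q = Unitary.conjStarAlgAut ℝ _ hA.eigenvectorUnitary
      (aeval (diagonal hA.eigenvalues) q) := by
    conv_lhs => rw [hA.spectral_theorem]
    exact aeval_algHom_apply _ _ _
  have h2 : aeval (diagonal hA.eigenvalues) q = diagonal (fun i => q.eval (hA.eigenvalues i)) := by
    have h3 : (diagonal hA.eigenvalues : Matrix V V ℝ)
        = diagonalAlgHom ℝ hA.eigenvalues := rfl
    rw [h3, aeval_algHom_apply]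
    simp only [diagonalAlgHom_apply]
    congr 1
    funext i
    have h4 := aeval_algHom_apply (Pi.evalAlgHom ℝ (fun _ : V => ℝ) i) hA.eigenvalues q
    simp only [Pi.evalAlgHom_apply] at h4
    rw [← h4, coe_aeval_eq_eval]
  rw [h1, h2, Unitary.conjStarAlgAut_apply]
  exact (posSemidef_diagonal_iff.mpr hq).mul_mul_conjTranspose_same _

open Matrix in
lemma aux_ratio {V : Type*} [Fintype V] [DecidableEq V] [Nonempty V] (M : Matrix V V ℝ)
    (hM : M.PosSemidef) (c : ℝ) (hc : M *ᵥ (fun _ => 1) = fun _ => c) (S : Finset V)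
    (hS : ∀ u ∈ S, ∀ v ∈ S, u ≠ v → M u v = 0) :
    c * (S.card : ℝ) ^ 2 ≤ Fintype.card V * ∑ u ∈ S, M u u := by
  set s : V → ℝ := fun v => if v ∈ S then 1 else 0 with hs
  set e : V → ℝ := fun _ => 1 with he
  have hce : M *ᵥ e = c • e := by rw [hc]; ext; simp [he]
  have hes : e ⬝ᵥ s = S.card := by simp [he, hs, dotProduct]
  have hee : e ⬝ᵥ e = Fintype.card V := by simp [he, dotProduct]
  have hT : s ⬝ᵥ (M *ᵥ s) = ∑ u ∈ S, M u u := by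
    simp only [dotProduct, mulVec, hs, ite_mul, one_mul, zero_mul, mul_ite, mul_one, mul_zero,
      Finset.sum_ite_mem, Finset.univ_inter]
    refine Finset.sum_congr rfl fun u hu => ?_
    exact Finset.sum_eq_single_of_mem u hu fun v hv hne => hS u hu v hv hne.symm
  have hMT : Mᵀ = M := by simpa [IsHermitian, conjTranspose_eq_transpose_of_trivial] using hM.1
  have hX : e ⬝ᵥ (M *ᵥ s) = c * S.card := by
    rw [dotProduct_mulVec, ← mulVec_transpose, hMT, hce, smul_dotProduct, hes, smul_eq_mul]
  have hse : s ⬝ᵥ e = S.card := by rw [dotProduct_comm, hes]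
  have h := hM.dotProduct_mulVec_nonneg ((Fintype.card V : ℝ) • s - (S.card : ℝ) • e)
  have hn : (0 : ℝ) < Fintype.card V := by exact_mod_cast Fintype.card_pos
  simp only [star_trivial, mulVec_sub, mulVec_smul, hce, sub_dotProduct, dotProduct_sub,
    smul_dotProduct, dotProduct_smul, hT, hX, hse, hee, smul_eq_mul] at h
  have h' : 0 ≤ (Fintype.card V : ℝ) * (Fintype.card V * ∑ u ∈ S, M u u - c * (S.card : ℝ) ^ 2) := by
    nlinarith [h]
  linarith [nonneg_of_mul_nonneg_right h' hn]

open Matrix in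
lemma aux_off {V : Type*} [Fintype V] [DecidableEq V] (G : SimpleGraph V) [DecidableRel G.Adj]
    (k : ℕ) (p : ℝ[X]) (hdeg : p.natDegree ≤ k) (u v : V) (h : k < G.dist u v) :
    (aeval (G.adjMatrix ℝ) p) u v = 0 := by
  rw [aeval_eq_sum_range, Matrix.sum_apply]
  refine Finset.sum_eq_zero fun i hi => ?_
  rw [Matrix.smul_apply, SimpleGraph.adjMatrix_pow_apply_eq_card_walk]
  have : IsEmpty { w : G.Walk u v | w.length = i } := by
    refine ⟨fun ⟨w, hw⟩ => ?_⟩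
    have h1 := SimpleGraph.dist_le w
    have h2 : w.length = i := hw
    have := Finset.mem_range.mp hi
    omega
  simp

open Matrix in
lemma aux_eig {V : Type*} [Fintype V] [DecidableEq V] (A : Matrix V V ℝ) (d : ℝ) (e : V → ℝ)
    (h : A *ᵥ e = d • e) (p : ℝ[X]) : (aeval A p) *ᵥ e = p.eval d • e := by
  induction p using Polynomial.induction_on' with
  | add p q hp hq => rw [map_add, add_mulVec, hp, hq, eval_add, add_smul]
  | monomial m a =>
    have hp : ∀ m : ℕ, A ^ m *ᵥ e = d ^ m • e := by
      intro m
      induction m with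
      | zero => simp
      | succ m ih => rw [pow_succ, ← mulVec_mulVec, h, mulVec_smul, ih, smul_smul, pow_succ, mul_comm]
    rw [aeval_monomial, ← Algebra.smul_def, smul_mulVec, hp, eval_monomial, smul_smul]

theorem stmt_0 {V : Type*} [Fintype V] [DecidableEq V]
    (G : SimpleGraph V) [DecidableRel G.Adj]
    (hconn : G.Connected) (n δ k : ℕ) (hn : Fintype.card V = n) (h0 : 0 < n)
    (hreg : G.IsRegularOfDegree δ) (hk : 1 ≤ k)
    (lam : Fin n → ℝ) (hanti : Antitone lam)
    (hchar : (G.adjMatrix ℝ).charpoly = ∏ i : Fin n, (X - C (lam i)))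
    (hlam1 : lam ⟨0, h0⟩ = (δ : ℝ))
    (p : ℝ[X]) (hdeg : p.natDegree ≤ k)
    (W L : ℝ)
    (hW : IsGreatest {x : ℝ | ∃ u : V, x = (Polynomial.aeval (G.adjMatrix ℝ) p) u u} W)
    (hL : IsLeast {x : ℝ | ∃ i : Fin n, 1 ≤ (i : ℕ) ∧ x = p.eval (lam i)} L)
    (hgt : p.eval (lam ⟨0, h0⟩) > L) :
    (indepNum (graphPower G k) : ℝ) ≤ (n : ℝ) * (W - L) / (p.eval (lam ⟨0, h0⟩) - L) := by
  classical
  have : Nonempty V := hconn.nonempty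
  have hA : (G.adjMatrix ℝ).IsHermitian := G.isHermitian_adjMatrix ℝ
  have hpsd : (aeval (G.adjMatrix ℝ) (p - C L)).PosSemidef := by
    refine aux_psd _ hA _ fun j => ?_
    have hr : (G.adjMatrix ℝ).charpoly.eval (hA.eigenvalues j) = 0 := by
      rw [hA.charpoly_eq, eval_prod]
      exact Finset.prod_eq_zero (Finset.mem_univ j) (by simp)
    rw [hchar, eval_prod, Finset.prod_eq_zero_iff] at hr
    obtain ⟨i, -, hi⟩ := hr
    have hi' : hA.eigenvalues j = lam i := by
      simpa [sub_eq_zero] using hi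
    rw [hi', eval_sub, eval_C, sub_nonneg]
    by_cases h1 : 1 ≤ (i : ℕ)
    · exact hL.2 ⟨i, h1, rfl⟩
    · have : i = ⟨0, h0⟩ := Fin.ext (by simp; omega)
      rw [this]; exact hgt.le
  have hMsub : ∀ u v, (aeval (G.adjMatrix ℝ) (p - C L)) u v
      = (aeval (G.adjMatrix ℝ) p) u v - if u = v then L else 0 := by
    intro u v
    rw [map_sub, aeval_C, Matrix.sub_apply, Matrix.algebraMap_matrix_apply]
    rfl
  have hne : (Set.Nonempty {n : ℕ | ∃ s : Finset V, s.card = n ∧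
      ∀ u ∈ s, ∀ v ∈ s, u ≠ v → ¬ (graphPower G k).Adj u v}) := ⟨0, ∅, by simp⟩
  have hbd : BddAbove {n : ℕ | ∃ s : Finset V, s.card = n ∧
      ∀ u ∈ s, ∀ v ∈ s, u ≠ v → ¬ (graphPower G k).Adj u v} := by
    refine ⟨Fintype.card V, ?_⟩
    rintro _ ⟨s, rfl, -⟩
    exact s.card_le_univ
  obtain ⟨S, hSc, hS⟩ := Nat.sSup_mem hne hbd
  change S.card = indepNum (graphPower G k) at hSc
  rw [← hSc]
  have hdist : ∀ u ∈ S, ∀ v ∈ S, u ≠ v → k < G.dist u v := by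
    intro u hu v hv huv
    by_contra hcon
    exact hS u hu v hv huv (by
      simp only [graphPower, SimpleGraph.fromRel_adj]
      exact ⟨huv, Or.inl (not_lt.mp hcon)⟩)
  set c : ℝ := p.eval (lam ⟨0, h0⟩) - L with hc
  have hcpos : 0 < c := sub_pos.mpr hgt
  have hmain := aux_ratio _ hpsd c (by
      have h1 : (G.adjMatrix ℝ).mulVec (fun _ => (1 : ℝ)) = (δ : ℝ) • (fun _ => (1 : ℝ)) := by
        ext v
        simpa using G.adjMatrix_mulVec_const_apply_of_regular (α := ℝ) (a := 1) hreg (v := v)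
      rw [aux_eig _ _ _ h1]
      ext
      simp [hc, hlam1]) S (by
      intro u hu v hv huv
      rw [hMsub, if_neg huv, sub_zero]
      exact aux_off G k p hdeg u v (hdist u hu v hv huv))
  have hsum : ∑ u ∈ S, (aeval (G.adjMatrix ℝ) (p - C L)) u u ≤ S.card * (W - L) := by
    rw [← nsmul_eq_mul]
    refine Finset.sum_le_card_nsmul _ _ _ fun u _ => ?_
    rw [hMsub, if_pos rfl]
    linarith [hW.2 ⟨u, rfl⟩]
  have hnpos : (0 : ℝ) < n := by exact_mod_cast h0
  rw [hn] at hmain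
  have hWL : 0 ≤ W - L := by
    obtain ⟨u⟩ := ‹Nonempty V›
    have h1 := hpsd.diag_nonneg (i := u)
    rw [hMsub, if_pos rfl] at h1
    linarith [hW.2 ⟨u, rfl⟩]
  rw [le_div_iff₀ hcpos]
  rcases Nat.eq_zero_or_pos S.card with h | h
  · rw [h]; simp; positivity
  · have hs : (0 : ℝ) < S.card := by exact_mod_cast h
    have h2 := mul_le_mul_of_nonneg_left hsum hnpos.le
    have h3 : (S.card : ℝ) * (S.card * c) ≤ S.card * (n * (W - L)) := by nlinarith
    exact le_of_mul_le_mul_left h3 hs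
end

section
/- Let G be a connected δ-regular graph on n vertices with δ ≥ 1, whose distinct adjacency eigenvalues are θ_0 = δ > θ_1 > ⋯ > θ_d. Then for every integer m ≥ 1, the independence number of the m-th strong power of G satisfies α(G^{⊠m}) ≤ (n·(−θ_d)/(δ − θ_d))^m; in particular the Shannon capacity of G is at most the Hoffman ratio bound n·(−θ_d)/(δ − θ_d). -/
open Polynomial

/-- The `m`-th strong power of a graph: two distinct `m`-tuples are adjacent iff
in every coordinate the entries are equal or adjacent. -/
def strongPower {V : Type*} (G : SimpleGraph V) (m : ℕ) : SimpleGraph (Fin m → V) :=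
  SimpleGraph.fromRel fun u v => ∀ j, u j = v j ∨ G.Adj (u j) (v j)

/-- The Shannon capacity of a graph, `sup_m α(G^{⊠m})^{1/m}`. -/
noncomputable def shannonCapacity {V : Type*} [Fintype V] (G : SimpleGraph V) : ℝ :=
  ⨆ m : ℕ+, (indepNum (strongPower G (m : ℕ)) : ℝ) ^ (((m : ℕ) : ℝ))⁻¹

theorem aux_gram {V : Type*} [Fintype V] [DecidableEq V]
    (G : SimpleGraph V) [DecidableRel G.Adj] (t : ℝ)
    (h : ∀ x ∈ spectrum ℝ (G.adjMatrix ℝ), t ≤ x) :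
    ∃ Y : Matrix V V ℝ, ∀ u v, ∑ k, Y k u * Y k v =
      (if G.Adj u v then 1 else 0) + (if u = v then -t else 0) := by
  have hP : (G.adjMatrix ℝ - algebraMap ℝ (Matrix V V ℝ) t).PosSemidef := by
    rw [Matrix.posSemidef_iff_isHermitian_and_spectrum_nonneg]
    constructor
    · ext u v
      simp [Matrix.algebraMap_matrix_apply, SimpleGraph.adj_comm, eq_comm]
    · intro x hx
      rw [sub_eq_add_neg, add_comm, ← spectrum.add_mem_iff] at hx
      have := h _ hx
      simp only [Set.mem_setOf_eq]
      linarith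
  obtain ⟨Y, hY⟩ := by
    open scoped MatrixOrder Matrix.Norms.L2Operator in
    exact CStarAlgebra.nonneg_iff_eq_star_mul_self.mp hP.nonneg
  refine ⟨Y, fun u v => ?_⟩
  have := congrFun (congrFun hY u) v
  simp only [Matrix.sub_apply, SimpleGraph.adjMatrix_apply, Matrix.algebraMap_matrix_apply,
    Matrix.star_eq_conjTranspose, Matrix.mul_apply, Matrix.conjTranspose_apply, star_trivial,
    Algebra.algebraMap_self, RingHom.id_apply] at this
  rw [← this]
  split_ifs <;> ring

theorem aux_bound {V : Type*} [Fintype V] [DecidableEq V] (m : ℕ) (Y : Matrix V V ℝ)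
    (τ c : ℝ) (hc : 0 < c) (hrow : ∀ u, ∑ v, ∑ k, Y k u * Y k v = c)
    (hdiag : ∀ u, ∑ k, Y k u * Y k u = τ) (hτ : 0 < τ)
    (S : Finset (Fin m → V))
    (hS : ∀ u ∈ S, ∀ v ∈ S, u ≠ v → ∃ j, ∑ k, Y k (u j) * Y k (v j) = 0) :
    (S.card : ℝ) ≤ ((Fintype.card V : ℝ) * τ / c) ^ m := by
  let Z : (Fin m → V) → (Fin m → V) → ℝ := fun K u => ∏ j, Y (K j) (u j)
  have hZ : ∀ u v, ∑ K, Z K u * Z K v = ∏ j, ∑ k, Y k (u j) * Y k (v j) := by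
    intro u v
    rw [Finset.prod_univ_sum, Fintype.piFinset_univ]
    simp only [Z, Finset.prod_mul_distrib]
  have hrowZ : ∀ u, ∑ v, ∑ K, Z K u * Z K v = c ^ m := by
    intro u
    simp only [hZ]
    have := Finset.prod_univ_sum (fun _ : Fin m => (Finset.univ : Finset V))
      (fun j v => ∑ k, Y k (u j) * Y k v)
    rw [Fintype.piFinset_univ] at this
    rw [← this]
    simp [hrow]
  have key : ∀ (A B : Finset (Fin m → V)),
      ∑ K, (∑ u ∈ A, Z K u) * (∑ v ∈ B, Z K v) = ∑ u ∈ A, ∑ v ∈ B, ∑ K, Z K u * Z K v := by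
    intro A B
    simp only [Finset.sum_mul_sum]
    rw [Finset.sum_comm]
    refine Finset.sum_congr rfl fun u _ => ?_
    rw [Finset.sum_comm]
  have cs := Finset.sum_mul_sq_le_sq_mul_sq Finset.univ
    (fun K => ∑ u ∈ S, Z K u) (fun K => ∑ v, Z K v)
  simp only [pow_two (∑ u ∈ S, Z _ u), pow_two (∑ u, Z _ u)] at cs
  rw [key, key, key] at cs
  have hSS : ∑ u ∈ S, ∑ v ∈ S, ∑ K, Z K u * Z K v = S.card * τ ^ m := by
    rw [← nsmul_eq_mul, ← Finset.sum_const]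
    refine Finset.sum_congr rfl fun u hu => ?_
    rw [Finset.sum_eq_single_of_mem u hu]
    · rw [hZ]; simp [hdiag]
    · intro v hv hne
      rw [hZ]
      obtain ⟨j, hj⟩ := hS u hu v hv hne.symm
      exact Finset.prod_eq_zero (Finset.mem_univ j) hj
  rw [hSS] at cs
  simp only [hrowZ, Finset.sum_const, nsmul_eq_mul, Finset.card_univ, Fintype.card_pi,
    Finset.prod_const, Fintype.card_fin] at cs
  push_cast at cs
  rw [div_pow, mul_pow, le_div_iff₀ (by positivity)]
  have hcm : 0 < c ^ m := by positivity
  rcases Nat.eq_zero_or_pos S.card with h0 | h0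
  · rw [h0]; simp; positivity
  · have h1 : (0 : ℝ) < S.card := by exact_mod_cast h0
    refine le_of_mul_le_mul_left ?_ (mul_pos h1 hcm)
    nlinarith [cs]

theorem stmt_1 {V : Type*} [Fintype V] [DecidableEq V]
    (G : SimpleGraph V) [DecidableRel G.Adj]
    (hconn : G.Connected) (n δ d : ℕ) (hn : Fintype.card V = n)
    (hδ : 1 ≤ δ) (hreg : G.IsRegularOfDegree δ)
    (θ : Fin (d + 1) → ℝ) (hanti : StrictAnti θ) (hθ0 : θ 0 = (δ : ℝ))
    (hspec : spectrum ℝ (G.adjMatrix ℝ) = Set.range θ) :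
    (∀ m : ℕ, 1 ≤ m →
      (indepNum (strongPower G m) : ℝ) ≤
        ((n : ℝ) * (-(θ (Fin.last d))) / ((δ : ℝ) - θ (Fin.last d))) ^ m) ∧
    shannonCapacity G ≤ (n : ℝ) * (-(θ (Fin.last d))) / ((δ : ℝ) - θ (Fin.last d)) := by
  obtain ⟨Y, hY⟩ := aux_gram G (θ (Fin.last d)) (by
    rw [hspec]
    rintro _ ⟨i, rfl⟩
    exact hanti.antitone (Fin.le_last i))
  generalize θ (Fin.last d) = t at *
  have ht : t < 0 := by
    obtain ⟨u⟩ := hconn.nonempty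
    have hd : 0 < G.degree u := by rw [hreg u]; omega
    obtain ⟨v, hv⟩ := (G.degree_pos_iff_exists_adj u).1 hd
    have h0 : 0 ≤ ∑ k, (Y k u - Y k v) ^ 2 := Finset.sum_nonneg fun _ _ => sq_nonneg _
    have h1 : ∑ k, (Y k u - Y k v) ^ 2 = ∑ k, Y k u * Y k u + ∑ k, Y k v * Y k v
        - 2 * ∑ k, Y k u * Y k v := by
      rw [Finset.mul_sum, ← Finset.sum_add_distrib, ← Finset.sum_sub_distrib]
      exact Finset.sum_congr rfl fun _ _ => by ring
    rw [h1, hY, hY, hY] at h0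
    simp [hv, hv.ne] at h0
    linarith
  have hc : 0 < (δ : ℝ) - t := by
    have : (0 : ℝ) ≤ δ := by positivity
    linarith
  have main : ∀ m : ℕ, 1 ≤ m →
      (indepNum (strongPower G m) : ℝ) ≤ ((n : ℝ) * (-t) / ((δ : ℝ) - t)) ^ m := by
    intro m _
    have hmem := Nat.sSup_mem (s := {n : ℕ | ∃ s : Finset (Fin m → V), s.card = n ∧
        ∀ u ∈ s, ∀ v ∈ s, u ≠ v → ¬ (strongPower G m).Adj u v})
      ⟨0, ∅, by simp⟩ ⟨Fintype.card (Fin m → V), by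
        rintro _ ⟨s, rfl, _⟩
        exact Finset.card_le_univ s⟩
    obtain ⟨S, hcard, hS⟩ := hmem
    have : indepNum (strongPower G m) = S.card := hcard.symm
    rw [this, ← hn]
    apply aux_bound m Y (-t) (δ - t) hc _ _ (by linarith) S
    · intro u hu v hv hne
      have h := hS u hu v hv hne
      simp only [strongPower, SimpleGraph.fromRel_adj, not_and, not_or] at h
      have h2 := (h hne).1
      push Not at h2
      obtain ⟨j, hj1, hj2⟩ := h2
      refine ⟨j, ?_⟩
      rw [hY]
      simp [hj1, hj2]
    · intro u
      simp only [hY, Finset.sum_add_distrib]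
      have := hreg u
      rw [← SimpleGraph.card_neighborFinset_eq_degree, SimpleGraph.neighborFinset_eq_filter] at this
      simp [this]
      ring
    · intro u
      simp [hY]
  refine ⟨main, ?_⟩
  have hh : 0 ≤ (n : ℝ) * (-t) / ((δ : ℝ) - t) := by
    have : 0 ≤ -t := by linarith
    positivity
  refine ciSup_le fun m => ?_
  calc _ ≤ (((n : ℝ) * (-t) / ((δ : ℝ) - t)) ^ (m : ℕ)) ^ (((m : ℕ) : ℝ))⁻¹ :=
        Real.rpow_le_rpow (by positivity) (main m m.2) (by positivity)
    _ = _ := Real.pow_rpow_inv_natCast hh m.ne_zero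
end

section
/- Let G be a connected δ-regular graph on n vertices with δ ≥ 3 that is 3-partially walk-regular, with distinct adjacency eigenvalues θ_0 = δ > θ_1 > ⋯ > θ_d where d ≥ 3 and θ_d < −1. Let n_t be the common number of triangles rooted at every vertex, and let θ_s (with 1 ≤ s ≤ d−1) be the smallest eigenvalue satisfying θ_s ≥ −(δ² + δθ_d − n_t)/(δ(θ_d + 1)). Then for every integer m ≥ 1, α((G³)^{⊠m}) ≤ H_3^m, where H_3 = n·(2n_t − δ(θ_s + θ_{s+1} + θ_d) − θ_s·θ_{s+1}·θ_d) / ((δ − θ_s)(δ − θ_{s+1})(δ − θ_d)); in particular the Shannon capacity of G³ is at most H_3. -/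
open Polynomial

theorem aux_tensor {V : Type*} [Fintype V] [DecidableEq V] (P : Matrix V V ℝ) (B : V → V → ℝ)
    (hB : ∀ u v, ∑ i, B i u * B i v = P u v) (c l : ℝ)
    (hc : ∀ u, P u u = c) (hl : ∀ u, ∑ v, P u v = l) (hl0 : 0 < l) (m : ℕ)
    (S : Finset (Fin m → V))
    (hS : ∀ u ∈ S, ∀ v ∈ S, u ≠ v → ∃ j, P (u j) (v j) = 0) :
    (S.card : ℝ) ≤ (Fintype.card V * c / l) ^ m := by
  classical
  have hten : ∀ (f g : Fin m → V → ℝ), ∑ i : Fin m → V, (∏ j, f j (i j)) * (∏ j, g j (i j))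
      = ∏ j, ∑ i, f j i * g j i := by
    intro f g
    rw [Finset.prod_univ_sum]
    simp [Finset.prod_mul_distrib]
  let X : (Fin m → V) → (Fin m → V) → ℝ := fun u i => ∏ j, B (i j) (u j)
  let b : V → ℝ := fun i => ∑ v, B i v
  let bb : (Fin m → V) → ℝ := fun i => ∏ j, b (i j)
  have hbx : ∀ u, ∑ i, b i * B i u = l := by
    intro u
    rw [← hl u]
    simp only [b, Finset.sum_mul]
    rw [Finset.sum_comm]
    refine Finset.sum_congr rfl fun v _ => ?_
    rw [← hB]
    exact Finset.sum_congr rfl fun i _ => mul_comm _ _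
  have hbb : ∑ i, b i * b i = Fintype.card V * l := by
    have : ∀ i, b i * b i = ∑ u, b i * B i u := fun i => by rw [← Finset.mul_sum]
    simp only [this]
    rw [Finset.sum_comm]
    simp [hbx]
  have h1 : ∑ i, bb i * (∑ u ∈ S, X u i) = S.card * l ^ m := by
    simp only [Finset.mul_sum]
    rw [Finset.sum_comm]
    have : ∀ u ∈ S, ∑ i, bb i * X u i = l ^ m := by
      intro u _
      have := hten (fun _ i => b i) (fun j i => B i (u j))
      simp only [hbx] at this
      simpa [bb, X] using this
    rw [Finset.sum_congr rfl this]
    simp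
  have h2 : ∑ i, bb i ^ 2 = (Fintype.card V * l) ^ m := by
    have := hten (fun _ i => b i) (fun _ i => b i)
    simp only [hbb] at this
    simp only [pow_two (bb _)]
    simpa [bb] using this
  have h3 : ∑ i, (∑ u ∈ S, X u i) ^ 2 = S.card * c ^ m := by
    simp only [pow_two (∑ u ∈ S, X u _), Finset.sum_mul_sum]
    rw [Finset.sum_comm]
    have : ∀ u ∈ S, ∑ i, ∑ v ∈ S, X u i * X v i = c ^ m := by
      intro u hu
      rw [Finset.sum_comm]
      have hx : ∀ v, ∑ i, X u i * X v i = ∏ j, P (u j) (v j) := by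
        intro v
        have := hten (fun j i => B i (u j)) (fun j i => B i (v j))
        simp only [hB] at this
        exact this
      simp only [hx]
      rw [Finset.sum_eq_single_of_mem u hu]
      · simp [hc]
      · intro v hv hne
        obtain ⟨j, hj⟩ := hS u hu v hv hne.symm
        exact Finset.prod_eq_zero (Finset.mem_univ j) hj
    rw [Finset.sum_congr rfl this]
    simp
  have hcs := Finset.sum_mul_sq_le_sq_mul_sq Finset.univ bb (fun i => ∑ u ∈ S, X u i)
  rw [h1, h2, h3] at hcs
  rw [div_pow, le_div_iff₀ (by positivity)]
  rcases S.eq_empty_or_nonempty with rfl | hne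
  · simp only [Finset.card_empty, Nat.cast_zero, zero_mul]
    rcases isEmpty_or_nonempty V with hV | ⟨⟨v⟩⟩
    · cases m <;> simp
    · have : 0 ≤ c := by
        rw [← hc v, ← hB]
        exact Finset.sum_nonneg fun i _ => mul_self_nonneg _
      positivity
  · have hp : (0 : ℝ) < S.card := by exact_mod_cast hne.card_pos
    have hlm : 0 < l ^ m := by positivity
    rw [mul_pow (Fintype.card V : ℝ)] at hcs ⊢
    have : (S.card * l ^ m : ℝ) * (S.card * l ^ m) ≤ (S.card * l ^ m) * (Fintype.card V ^ m * c ^ m) := by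
      nlinarith
    exact le_of_mul_le_mul_left this (by positivity)

theorem aux_decomp {V : Type*} [Fintype V] [DecidableEq V] (A : Matrix V V ℝ)
    (hA : A.IsHermitian) (a b c : ℝ)
    (h : ∀ x ∈ spectrum ℝ A, 0 ≤ (x - a) * (x - b) * (x - c)) :
    ∃ B : V → V → ℝ, ∀ u v, ∑ i, B i u * B i v =
      ((A - a • 1) * (A - b • 1) * (A - c • 1)) u v := by
  have hh := fun i => h _ (hA.eigenvalues_mem_spectrum_real i)
  set e := hA.eigenvalues with he
  refine ⟨fun i u => Real.sqrt ((e i - a) * (e i - b) * (e i - c)) * 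
    (hA.eigenvectorUnitary : Matrix V V ℝ) u i, fun u v => ?_⟩
  have hd : ∀ a : ℝ, A - a • 1 = Unitary.conjStarAlgAut ℝ _ hA.eigenvectorUnitary
      (Matrix.diagonal (fun i => e i - a)) := by
    intro a
    have : Matrix.diagonal (fun i => e i - a) =
      Matrix.diagonal (RCLike.ofReal ∘ hA.eigenvalues) - a • (1 : Matrix V V ℝ) := by
      ext i j
      by_cases hij : i = j
      · subst hij; simp [he]
      · simp [hij]
    rw [this, map_sub, map_smul, map_one, ← hA.spectral_theorem]
  rw [hd, hd, hd, ← map_mul, ← map_mul, Matrix.diagonal_mul_diagonal,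
    Matrix.diagonal_mul_diagonal, Unitary.conjStarAlgAut_apply, Matrix.mul_apply]
  refine Finset.sum_congr rfl fun i _ => ?_
  rw [Matrix.mul_diagonal, Matrix.star_apply]
  have := Real.mul_self_sqrt (hh i)
  simp only [star_trivial]
  linear_combination ((hA.eigenvectorUnitary : Matrix V V ℝ) u i *
    (hA.eigenvectorUnitary : Matrix V V ℝ) v i) * this

theorem aux_indep {W : Type*} [Fintype W] (H : SimpleGraph W) :
    ∃ s : Finset W, s.card = indepNum H ∧ ∀ u ∈ s, ∀ v ∈ s, u ≠ v → ¬ H.Adj u v := by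
  have := Nat.sSup_mem (s := {n : ℕ | ∃ s : Finset W, s.card = n ∧
    ∀ u ∈ s, ∀ v ∈ s, u ≠ v → ¬ H.Adj u v}) ⟨0, ∅, by simp⟩
    ⟨Fintype.card W, by rintro _ ⟨s, rfl, _⟩; exact s.card_le_univ⟩
  exact this

theorem aux_entry {V : Type*} [Fintype V] [DecidableEq V]
    (G : SimpleGraph V) [DecidableRel G.Adj] (u v : V) (k : ℕ) (h : k < G.dist u v) :
    (G.adjMatrix ℝ ^ k) u v = 0 := by
  rw [SimpleGraph.adjMatrix_pow_apply_eq_card_walk]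
  norm_cast
  rw [Fintype.card_eq_zero_iff]
  refine ⟨fun p => ?_⟩
  have h1 := p.2
  have h2 := SimpleGraph.dist_le p.1
  simp only [Set.mem_ofPred_eq] at h1
  omega

theorem stmt_3 {V : Type*} [Fintype V] [DecidableEq V]
    (G : SimpleGraph V) [DecidableRel G.Adj]
    (hconn : G.Connected) (n δ d nt : ℕ) (hn : Fintype.card V = n)
    (hδ : 3 ≤ δ) (hreg : G.IsRegularOfDegree δ) (hd : 3 ≤ d)
    (hwr : ∀ ℓ : ℕ, ℓ ≤ 3 → ∀ u v : V,
      ((G.adjMatrix ℝ) ^ ℓ) u u = ((G.adjMatrix ℝ) ^ ℓ) v v)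
    (θ : Fin (d + 1) → ℝ) (hanti : StrictAnti θ) (hθ0 : θ 0 = (δ : ℝ))
    (hspec : spectrum ℝ (G.adjMatrix ℝ) = Set.range θ)
    (hθd : θ (Fin.last d) < -1)
    (hnt : ∀ u : V, ((G.adjMatrix ℝ) ^ 3) u u = 2 * (nt : ℝ))
    (s : ℕ) (hs1 : 1 ≤ s) (hsd : s ≤ d - 1)
    (hsge : θ ⟨s, by omega⟩ ≥
      -(((δ : ℝ) ^ 2 + (δ : ℝ) * θ (Fin.last d) - (nt : ℝ)) /
        ((δ : ℝ) * (θ (Fin.last d) + 1))))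
    (hsmin : ∀ j : Fin (d + 1),
      θ j ≥ -(((δ : ℝ) ^ 2 + (δ : ℝ) * θ (Fin.last d) - (nt : ℝ)) /
        ((δ : ℝ) * (θ (Fin.last d) + 1))) →
      θ ⟨s, by omega⟩ ≤ θ j)
    (H3 : ℝ)
    (hH3 : H3 = (n : ℝ) *
      (2 * (nt : ℝ) - (δ : ℝ) * (θ ⟨s, by omega⟩ + θ ⟨s + 1, by omega⟩ + θ (Fin.last d))
        - θ ⟨s, by omega⟩ * θ ⟨s + 1, by omega⟩ * θ (Fin.last d)) /
      (((δ : ℝ) - θ ⟨s, by omega⟩) * ((δ : ℝ) - θ ⟨s + 1, by omega⟩) *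
        ((δ : ℝ) - θ (Fin.last d)))) :
    (∀ m : ℕ, 1 ≤ m →
      (indepNum (strongPower (graphPower G 3) m) : ℝ) ≤ H3 ^ m) ∧
    shannonCapacity (graphPower G 3) ≤ H3 := by
  have key : ∀ m : ℕ, (indepNum (strongPower (graphPower G 3) m) : ℝ) ≤ H3 ^ m := by
    intro m
    have hsymm : (G.adjMatrix ℝ).IsHermitian := by
      rw [Matrix.IsHermitian, Matrix.conjTranspose_eq_transpose_of_trivial]
      exact G.transpose_adjMatrix
    set a := θ ⟨s, by omega⟩ with ha
    set b := θ ⟨s + 1, by omega⟩ with hb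
    set c := θ (Fin.last d) with hc
    have had : a < δ := by
      rw [← hθ0]; exact hanti (by rw [Fin.lt_def]; exact hs1)
    have hba : b < a := hanti (by rw [Fin.lt_def]; simp)
    have hcb : c ≤ b := hanti.antitone (Fin.le_last _)
    obtain ⟨B, hB⟩ := aux_decomp (G.adjMatrix ℝ) hsymm a b c (by
      rw [hspec]
      rintro _ ⟨j, rfl⟩
      have hjc : c ≤ θ j := hanti.antitone (Fin.le_last _)
      refine mul_nonneg ?_ (by linarith)
      rcases le_or_gt j.1 s with h | h
      · have : a ≤ θ j := hanti.antitone (by rw [Fin.le_def]; simpa using h)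
        exact mul_nonneg (by linarith) (by linarith)
      · have : θ j ≤ b := hanti.antitone (by rw [Fin.le_def]; simpa using h)
        exact mul_nonneg_of_nonpos_of_nonpos (by linarith) (by linarith))
    set A := G.adjMatrix ℝ with hAdef
    have hexp : (A - a • 1) * (A - b • 1) * (A - c • 1) =
        A ^ 3 - (a + b + c) • A ^ 2 + (a * b + a * c + b * c) • A ^ 1 - (a * b * c) • A ^ 0 := by
      simp only [sub_mul, mul_sub, smul_mul_assoc, mul_smul_comm, one_mul, mul_one, smul_sub,
        smul_smul, pow_succ, pow_zero, add_smul]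
      simp only [mul_comm, mul_left_comm]
      abel
    obtain ⟨S, hScard, hS⟩ := aux_indep (strongPower (graphPower G 3) m)
    rw [← hScard]
    have hl0 : 0 < ((δ : ℝ) - a) * (δ - b) * (δ - c) :=
      mul_pos (mul_pos (by linarith) (by linarith)) (by linarith)
    have := aux_tensor ((A - a • 1) * (A - b • 1) * (A - c • 1)) B hB
      (2 * nt - δ * (a + b + c) - a * b * c) (((δ : ℝ) - a) * (δ - b) * (δ - c)) ?_ ?_ hl0 m S ?_
    · rw [hH3, ← hn]; exact this
    · intro u
      have h2 : (A ^ 2) u u = δ := by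
        rw [pow_two, SimpleGraph.adjMatrix_mul_self_apply_self, hreg u]
      rw [hexp]
      simp only [Matrix.sub_apply, Matrix.add_apply, Matrix.smul_apply, hnt, h2, pow_one, pow_zero,
        Matrix.one_apply_eq]
      simp [hAdef]
      ring
    · intro u
      have h1 : ∀ x t : ℝ, (A - x • 1).mulVec (fun _ => t) = fun _ => (δ - x) * t := by
        intro x t
        ext v
        have := G.adjMatrix_mulVec_const_apply_of_regular (α := ℝ) (a := t) hreg (v := v)
        rw [Matrix.sub_mulVec, Matrix.smul_mulVec, Matrix.one_mulVec, Pi.sub_apply]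
        have h' : (A.mulVec (fun _ => t)) v = δ * t := this
        rw [h']
        simp [sub_mul]
      have h2 : (((A - a • 1) * (A - b • 1) * (A - c • 1)).mulVec (fun _ => 1)) u =
          ∑ v, ((A - a • 1) * (A - b • 1) * (A - c • 1)) u v := by
        simp [Matrix.mulVec, dotProduct]
      rw [← h2, ← Matrix.mulVec_mulVec, ← Matrix.mulVec_mulVec, h1, h1, h1]
      ring
    · intro u hu v hv huv
      by_contra! hcon
      refine hS u hu v hv huv ?_
      rw [strongPower, SimpleGraph.fromRel_adj]
      refine ⟨huv, Or.inl fun j => ?_⟩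
      by_cases hj : u j = v j
      · exact Or.inl hj
      · right
        rw [graphPower, SimpleGraph.fromRel_adj]
        refine ⟨hj, Or.inl ?_⟩
        by_contra! hd3
        refine hcon j ?_
        rw [hexp]
        simp only [Matrix.sub_apply, Matrix.add_apply, Matrix.smul_apply]
        rw [aux_entry G _ _ 3 hd3, aux_entry G _ _ 2 (by omega), aux_entry G _ _ 1 (by omega),
          aux_entry G _ _ 0 (by omega)]
        simp
  refine ⟨fun m _ => key m, ?_⟩
  have hH0 : 0 ≤ H3 := by
    have := key 1
    rw [pow_one] at this
    exact le_trans (Nat.cast_nonneg _) this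
  refine ciSup_le fun m => ?_
  have hm : ((m : ℕ) : ℝ) ≠ 0 := by exact_mod_cast m.ne_zero
  calc _ ≤ (H3 ^ (m : ℕ)) ^ (((m : ℕ) : ℝ))⁻¹ :=
        Real.rpow_le_rpow (Nat.cast_nonneg _) (key m) (by positivity)
    _ = H3 := Real.pow_rpow_inv_natCast hH0 m.ne_zero
end

section
/- Let G be a connected δ-regular graph on n vertices with δ ≥ 1, whose distinct adjacency eigenvalues are θ_0 = δ > θ_1 > ⋯ > θ_d. If the independence number of G equals the Hoffman ratio bound, α(G) = n·(−θ_d)/(δ − θ_d), then for every integer m ≥ 1 one has α(G^{⊠m}) = α(G)^m; in particular the Shannon capacity Θ(G) equals n·(−θ_d)/(δ − θ_d). -/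
open Polynomial

lemma aux_bdd {V : Type*} [Fintype V] (G : SimpleGraph V) :
    BddAbove {n : ℕ | ∃ s : Finset V, s.card = n ∧ ∀ u ∈ s, ∀ v ∈ s, u ≠ v → ¬ G.Adj u v} :=
  ⟨Fintype.card V, by rintro n ⟨s, rfl, -⟩; exact s.card_le_univ⟩

lemma aux_attained {V : Type*} [Fintype V] (G : SimpleGraph V) :
    ∃ s : Finset V, s.card = indepNum G ∧ ∀ u ∈ s, ∀ v ∈ s, u ≠ v → ¬ G.Adj u v :=
  Nat.sSup_mem (s := {n : ℕ | ∃ s : Finset V, s.card = n ∧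
    ∀ u ∈ s, ∀ v ∈ s, u ≠ v → ¬ G.Adj u v}) ⟨0, ∅, by simp⟩ (aux_bdd G)

lemma aux_le {V : Type*} [Fintype V] (G : SimpleGraph V) (s : Finset V)
    (h : ∀ u ∈ s, ∀ v ∈ s, u ≠ v → ¬ G.Adj u v) : s.card ≤ indepNum G :=
  le_csSup (aux_bdd G) ⟨s, rfl, h⟩

lemma aux_lower {V : Type*} [Fintype V] (G : SimpleGraph V) (m : ℕ) :
    indepNum G ^ m ≤ indepNum (strongPower G m) := by
  classical
  obtain ⟨s, hs, hi⟩ := aux_attained G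
  have := aux_le (strongPower G m) (Fintype.piFinset fun _ => s) (by
    intro u hu v hv huv hadj
    rw [Fintype.mem_piFinset] at hu hv
    simp only [strongPower, SimpleGraph.fromRel_adj] at hadj
    apply huv
    funext j
    by_contra hne
    rcases hadj.2 with h | h
    · exact hi _ (hu j) _ (hv j) hne ((h j).resolve_left hne)
    · exact hi _ (hv j) _ (hu j) (Ne.symm hne) ((h j).resolve_left (Ne.symm hne)))
  simpa [Fintype.card_piFinset, hs] using this

/-- Lovász-type bound from a Gram representation of `K` with a coordinate equal to one. -/
lemma aux_upper {V ι : Type*} [Fintype V] [Fintype ι] (G : SimpleGraph V) (m : ℕ) (a : ℝ)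
    (B : ι → V → ℝ) (i0 : ι) (hB0 : ∀ v, B i0 v = 1)
    (hdiag : ∀ v, ∑ i, B i v * B i v = a)
    (ha : 0 ≤ a) (hoff : ∀ u v, u ≠ v → ¬ G.Adj u v → ∑ i, B i u * B i v = 0) :
    (indepNum (strongPower G m) : ℝ) ≤ a ^ m := by
  classical
  obtain ⟨s, hs, hi⟩ := aux_attained (strongPower G m)
  have h1 : ∀ u v : Fin m → V, ∑ f : Fin m → ι, (∏ j, B (f j) (u j)) * ∏ j, B (f j) (v j)
      = ∏ j, ∑ i, B i (u j) * B i (v j) := by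
    intro u v
    rw [Finset.prod_univ_sum]
    simp [Finset.prod_mul_distrib]
  have h2 : ∀ u ∈ s, ∀ v ∈ s, ∏ j, ∑ i, B i (u j) * B i (v j) = if u = v then a ^ m else 0 := by
    intro u hu v hv
    split_ifs with h
    · subst h; simp [hdiag]
    · have := hi u hu v hv h
      simp only [strongPower, SimpleGraph.fromRel_adj] at this
      have h3 : ¬ ∀ j, u j = v j ∨ G.Adj (u j) (v j) := fun h' => this ⟨h, Or.inl h'⟩
      push Not at h3
      obtain ⟨j, hj1, hj2⟩ := h3
      exact Finset.prod_eq_zero (Finset.mem_univ j) (hoff _ _ hj1 hj2)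
  have h3 : ∑ f : Fin m → ι, (∑ u ∈ s, ∏ j, B (f j) (u j)) ^ 2 = s.card * a ^ m := by
    simp_rw [sq, Finset.sum_mul_sum]
    rw [Finset.sum_comm]
    have : ∀ u ∈ s, ∑ f : Fin m → ι, ∑ v ∈ s, (∏ j, B (f j) (u j)) * ∏ j, B (f j) (v j) = a ^ m := by
      intro u hu
      rw [Finset.sum_comm, Finset.sum_congr rfl (fun v hv => (h1 u v).trans (h2 u hu v hv))]
      simp [hu]
    rw [Finset.sum_congr rfl this]
    simp
  have h4 : (s.card : ℝ) ^ 2 ≤ s.card * a ^ m := by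
    rw [← h3]
    refine le_trans (le_of_eq ?_) (Finset.single_le_sum
      (f := fun f : Fin m → ι => (∑ u ∈ s, ∏ j, B (f j) (u j)) ^ 2)
      (fun _ _ => sq_nonneg _) (Finset.mem_univ (fun _ => i0)))
    simp [hB0]
  rw [← hs]
  rcases s.eq_empty_or_nonempty with h | ⟨w, hw⟩
  · subst h; simp; positivity
  · have : (0:ℝ) < s.card := by exact_mod_cast Finset.card_pos.2 ⟨w, hw⟩
    nlinarith

open Matrix in
lemma aux_gram_s4 {V : Type*} [Fintype V] [DecidableEq V]
    (G : SimpleGraph V) [DecidableRel G.Adj] (n δ : ℕ) (hn : Fintype.card V = n) (hn0 : 0 < n)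
    (hreg : G.IsRegularOfDegree δ) (τ : ℝ) (hlt : 0 < (δ : ℝ) - τ)
    (hM : (G.adjMatrix ℝ - τ • (1 : Matrix V V ℝ)).PosSemidef) :
    (((n : ℝ) / ((δ : ℝ) - τ)) • (G.adjMatrix ℝ - τ • (1 : Matrix V V ℝ))
      - Matrix.of fun _ _ => (1 : ℝ)).PosSemidef := by
  set k : ℝ := (n : ℝ) / ((δ : ℝ) - τ) with hk
  set M := G.adjMatrix ℝ - τ • (1 : Matrix V V ℝ) with hMdef
  have hnR : (0 : ℝ) < n := by exact_mod_cast hn0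
  have hk0 : 0 < k := div_pos hnR hlt
  have hMT : Mᵀ = M := by simp [hMdef]
  refine Matrix.PosSemidef.of_dotProduct_mulVec_nonneg ?_ ?_
  · ext i j
    have := congrFun (congrFun hMT i) j
    simp only [Matrix.transpose_apply] at this
    simp [this]
  · intro x
    have hM1 : ∀ v, ∑ w, M v w = (δ : ℝ) - τ := by
      intro v
      have h1 := SimpleGraph.adjMatrix_mulVec_const_apply_of_regular (α := ℝ) (a := 1) hreg (v := v)
      simp [Matrix.mulVec, dotProduct] at h1
      simp [hMdef, Finset.sum_sub_distrib, Matrix.one_apply]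
      exact h1
    have hM2 : ∀ v, ∑ w, M w v = (δ : ℝ) - τ := by
      intro v
      rw [← hM1 v]
      exact Finset.sum_congr rfl fun w _ => congrFun (congrFun hMT v) w
    set S := ∑ v, x v with hS
    have hq := hM.dotProduct_mulVec_nonneg (fun v => x v - S / n)
    have e1 : ∑ v, ∑ w, M v w * x w = ((δ : ℝ) - τ) * S := by
      rw [Finset.sum_comm]
      simp_rw [← Finset.sum_mul, hM2, ← Finset.mul_sum]
      rfl
    have e2 : ∑ v, ∑ w, x v * M v w = ((δ : ℝ) - τ) * S := by
      simp_rw [← Finset.mul_sum, hM1, ← Finset.sum_mul]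
      rw [mul_comm]
    have e3 : ∑ v, ∑ w, M v w = ((δ : ℝ) - τ) * n := by
      simp [hM1, hn]; ring
    have expand : star (fun v => x v - S / n) ⬝ᵥ (M *ᵥ (fun v => x v - S / n))
        = (∑ v, ∑ w, x v * M v w * x w) - ((δ : ℝ) - τ) * S ^ 2 / n := by
      have : star (fun v => x v - S / n) ⬝ᵥ (M *ᵥ (fun v => x v - S / n))
        = (∑ v, ∑ w, x v * M v w * x w) - (S / n) * (∑ v, ∑ w, M v w * x w)
          - (S / n) * (∑ v, ∑ w, x v * M v w) + (S / n) ^ 2 * ∑ v, ∑ w, M v w := by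
        simp only [dotProduct, Matrix.mulVec, Finset.mul_sum, ← Finset.sum_sub_distrib,
          ← Finset.sum_add_distrib]
        refine Finset.sum_congr rfl fun v _ => Finset.sum_congr rfl fun w _ => ?_
        simp
        ring
      rw [this, e1, e2, e3]
      field_simp
      ring
    rw [expand] at hq
    have goal_eq : star x ⬝ᵥ ((k • M - Matrix.of fun _ _ => (1 : ℝ)) *ᵥ x)
        = k * (∑ v, ∑ w, x v * M v w * x w) - S ^ 2 := by
      rw [sq, hS, Finset.sum_mul_sum]
      simp only [dotProduct, Matrix.mulVec, Finset.mul_sum, ← Finset.sum_sub_distrib]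
      refine Finset.sum_congr rfl fun v _ => Finset.sum_congr rfl fun w _ => ?_
      simp
      ring
    rw [goal_eq]
    have := mul_nonneg hk0.le hq
    have e4 : k * (((δ : ℝ) - τ) * S ^ 2 / n) = S ^ 2 := by
      rw [hk]; field_simp
    rw [mul_sub, e4] at this
    exact this

theorem stmt_4 {V : Type*} [Fintype V] [DecidableEq V]
    (G : SimpleGraph V) [DecidableRel G.Adj]
    (hconn : G.Connected) (n δ d : ℕ) (hn : Fintype.card V = n)
    (hδ : 1 ≤ δ) (hreg : G.IsRegularOfDegree δ)
    (θ : Fin (d + 1) → ℝ) (hanti : StrictAnti θ) (hθ0 : θ 0 = (δ : ℝ))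
    (hspec : spectrum ℝ (G.adjMatrix ℝ) = Set.range θ)
    (hα : (indepNum G : ℝ) = (n : ℝ) * (-(θ (Fin.last d))) / ((δ : ℝ) - θ (Fin.last d))) :
    (∀ m : ℕ, 1 ≤ m → indepNum (strongPower G m) = (indepNum G) ^ m) ∧
    shannonCapacity G = (n : ℝ) * (-(θ (Fin.last d))) / ((δ : ℝ) - θ (Fin.last d)) := by
  have : Nonempty V := hconn.nonempty
  obtain ⟨v0⟩ := this
  have hn0 : 0 < n := hn ▸ Fintype.card_pos_iff.2 ⟨v0⟩
  set τ := θ (Fin.last d) with hτ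
  have hM : (G.adjMatrix ℝ - τ • (1 : Matrix V V ℝ)).PosSemidef := by
    have hH : (G.adjMatrix ℝ - τ • (1 : Matrix V V ℝ)).IsHermitian := by
      have : (G.adjMatrix ℝ - τ • (1 : Matrix V V ℝ)).transpose
        = (G.adjMatrix ℝ - τ • (1 : Matrix V V ℝ)) := by simp
      rw [Matrix.IsHermitian, Matrix.conjTranspose_eq_transpose_of_trivial, this]
    rw [Matrix.posSemidef_iff_isHermitian_and_spectrum_nonneg]
    refine ⟨hH, ?_⟩
    intro x hx
    have h2 : x + τ ∈ spectrum ℝ (G.adjMatrix ℝ) := by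
      rw [spectrum.mem_iff] at hx ⊢
      convert hx using 2
      rw [Algebra.algebraMap_eq_smul_one, Algebra.algebraMap_eq_smul_one, add_smul]
      abel
    rw [hspec] at h2
    obtain ⟨i, hi⟩ := h2
    have : θ (Fin.last d) ≤ θ i := hanti.antitone (Fin.le_last i)
    show (0:ℝ) ≤ x
    linarith
  have hτ0 : τ ≤ 0 := by
    have := hM.diag_nonneg (i := v0)
    simp at this
    linarith
  have hδR : (1 : ℝ) ≤ δ := by exact_mod_cast hδ
  have hlt : 0 < (δ : ℝ) - τ := by linarith
  have hP := aux_gram_s4 G n δ hn hn0 hreg τ hlt hM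
  obtain ⟨N, f, hf⟩ := Matrix.posSemidef_iff_eq_sum_vecMulVec.1 hP
  have hent : ∀ u v, ∑ i, f i u * f i v
      = (n : ℝ) / ((δ : ℝ) - τ) * (G.adjMatrix ℝ u v - if u = v then τ else 0) - 1 := by
    intro u v
    have := congrFun (congrFun hf u) v
    rw [Matrix.sum_apply] at this
    simp [Matrix.vecMulVec_apply, Matrix.one_apply] at this
    simp [← this]
  have hup : ∀ m : ℕ, (indepNum (strongPower G m) : ℝ) ≤ (indepNum G : ℝ) ^ m := by
    intro m
    refine aux_upper G m _ (fun (i : Option (Fin N)) v => i.elim 1 (fun i => f i v)) none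
      (fun _ => rfl) ?_ (by positivity) ?_
    · intro v
      rw [Fintype.sum_option]
      simp only [Option.elim]
      rw [hent, hα]
      simp
      ring
    · intro u v huv hadj
      rw [Fintype.sum_option]
      simp only [Option.elim]
      rw [hent]
      simp [huv, hadj]
  have hmain : ∀ m : ℕ, indepNum (strongPower G m) = (indepNum G) ^ m := fun m =>
    le_antisymm (by exact_mod_cast hup m) (aux_lower G m)
  refine ⟨fun m _ => hmain m, ?_⟩
  rw [← hα, shannonCapacity]
  have : ∀ m : ℕ+, (indepNum (strongPower G (m : ℕ)) : ℝ) ^ (((m : ℕ) : ℝ))⁻¹ = indepNum G := by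
    intro m
    rw [hmain, Nat.cast_pow, Real.pow_rpow_inv_natCast (by positivity) m.ne_zero]
  simp_rw [this]
  exact ciSup_const
end

section
/- Let G be a connected δ-regular graph on n vertices with δ ≥ 1 and minimum adjacency eigenvalue θ_d. Then there exists a real symmetric matrix M, with rows and columns indexed by V, such that M_{uv} = 1 whenever u = v or u and v are distinct and nonadjacent in G, and every eigenvalue of M is at most n·(−θ_d)/(δ − θ_d). Consequently, the Lovász theta number of G satisfies ϑ(G) ≤ n·(−θ_d)/(δ − θ_d). -/
open Polynomial

/-- The Lovász theta number of a graph `H`: the minimum, over all real symmetric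
matrices `M` with `M u v = 1` whenever `u = v` or `u, v` are nonadjacent in `H`,
of the largest eigenvalue of `M`. -/
noncomputable def lovaszTheta {V : Type*} [Fintype V] [DecidableEq V] (H : SimpleGraph V) : ℝ :=
  sInf {r : ℝ | ∃ M : Matrix V V ℝ, M.IsSymm ∧
    (∀ u v : V, ¬ H.Adj u v → M u v = 1) ∧ IsGreatest (spectrum ℝ M) r}

theorem spec_trace_aux {V : Type*} [Fintype V] [DecidableEq V] (M : Matrix V V ℝ)
    (hM : M.IsHermitian) : ∑ i, hM.eigenvalues i = M.trace := by
  have := hM.trace_eq_sum_eigenvalues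
  simpa using this.symm

theorem spec_vec_aux {V : Type*} [Fintype V] [DecidableEq V] (M : Matrix V V ℝ) (x : ℝ) :
    x ∈ spectrum ℝ M ↔ ∃ v : V → ℝ, v ≠ 0 ∧ M.mulVec v = x • v := by
  rw [← Matrix.spectrum_toLin', ← Module.End.hasEigenvalue_iff_mem_spectrum]
  constructor
  · intro h
    obtain ⟨v, hv⟩ := h.exists_hasEigenvector
    exact ⟨v, hv.2, by simpa using hv.apply_eq_smul⟩
  · rintro ⟨v, hv, h⟩
    exact Module.End.hasEigenvalue_of_hasEigenvector
      (Module.End.hasEigenvector_iff.2 ⟨Module.End.mem_eigenspace_iff.2 (by simpa using h), hv⟩)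

theorem stmt_7 {V : Type*} [Fintype V] [DecidableEq V]
    (G : SimpleGraph V) [DecidableRel G.Adj]
    (hconn : G.Connected) (n δ : ℕ) (hn : Fintype.card V = n) (hδ : 1 ≤ δ)
    (hreg : G.IsRegularOfDegree δ)
    (θd : ℝ) (hθd : IsLeast (spectrum ℝ (G.adjMatrix ℝ)) θd) :
    (∃ M : Matrix V V ℝ, M.IsSymm ∧
      (∀ u v : V, ¬ G.Adj u v → M u v = 1) ∧
      ∀ x ∈ spectrum ℝ M, x ≤ (n : ℝ) * (-θd) / ((δ : ℝ) - θd)) ∧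
    lovaszTheta G ≤ (n : ℝ) * (-θd) / ((δ : ℝ) - θd) := by
  classical
  have : Nonempty V := hconn.nonempty
  have hn0 : 0 < n := hn ▸ Fintype.card_pos
  have hnR : (0 : ℝ) < n := by exact_mod_cast hn0
  have hA : (G.adjMatrix ℝ).IsHermitian := by
    rw [Matrix.IsHermitian, Matrix.conjTranspose_eq_transpose_of_trivial]
    exact G.transpose_adjMatrix
  have hθ : θd ≤ 0 := by
    by_contra hpos
    push Not at hpos
    have h1 := spec_trace_aux _ hA
    rw [SimpleGraph.trace_adjMatrix] at h1
    have h2 : 0 < ∑ i, hA.eigenvalues i := Finset.sum_pos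
      (fun i _ => lt_of_lt_of_le hpos (hθd.2 (hA.eigenvalues_mem_spectrum_real i)))
      Finset.univ_nonempty
    linarith
  have hδR : (1 : ℝ) ≤ δ := by exact_mod_cast hδ
  have hd : 0 < (δ : ℝ) - θd := by linarith
  obtain ⟨c, hc⟩ : ∃ c : ℝ, c = n / ((δ : ℝ) - θd) := ⟨_, rfl⟩
  have hc0 : 0 < c := hc ▸ div_pos hnR hd
  have hT : (n : ℝ) * (-θd) / ((δ : ℝ) - θd) = -(c * θd) := by rw [hc]; ring
  have hcn : (n : ℝ) - c * δ = -(c * θd) := by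
    have : c * (δ - θd) = n := by rw [hc]; field_simp
    linarith
  rw [hT]
  obtain ⟨M, hMdef⟩ : ∃ M : Matrix V V ℝ, M = Matrix.of (fun _ _ => 1) - c • G.adjMatrix ℝ :=
    ⟨_, rfl⟩
  have hMs : M.IsSymm := by
    ext u v
    simp [hMdef, SimpleGraph.adjMatrix_apply, G.adj_comm]
  have hM1 : ∀ u v : V, ¬ G.Adj u v → M u v = 1 := by
    intro u v h
    simp [hMdef, SimpleGraph.adjMatrix_apply, h]
  have hMx : ∀ x ∈ spectrum ℝ M, x ≤ -(c * θd) := by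
    intro x hx
    obtain ⟨v, hv0, hv⟩ := (spec_vec_aux _ _).1 hx
    have hpt : ∀ u, (∑ w, v w) - c * (G.adjMatrix ℝ).mulVec v u = x * v u := by
      intro u
      have := congrFun hv u
      rw [hMdef, Matrix.sub_mulVec, Matrix.smul_mulVec] at this
      simpa [Matrix.mulVec, dotProduct] using this
    have hsumA : ∑ u, (G.adjMatrix ℝ).mulVec v u = δ * ∑ w, v w := by
      simp only [Matrix.mulVec, dotProduct]
      rw [Finset.sum_comm, Finset.mul_sum]
      refine Finset.sum_congr rfl fun w _ => ?_
      rw [← Finset.sum_mul]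
      congr 1
      rw [← hreg w]
      simp [SimpleGraph.adjMatrix_apply, G.adj_comm _ w, ← SimpleGraph.card_neighborFinset_eq_degree,
        SimpleGraph.neighborFinset_eq_filter]
    have hs : (n - c * δ) * (∑ w, v w) = x * ∑ w, v w := by
      have := Finset.sum_congr (rfl : (Finset.univ : Finset V) = _) (fun u _ => hpt u)
      rw [Finset.sum_sub_distrib, ← Finset.mul_sum, ← Finset.mul_sum, hsumA] at this
      simp [hn] at this
      linarith
    by_cases h0 : ∑ w, v w = 0
    · have hmem : -(x / c) ∈ spectrum ℝ (G.adjMatrix ℝ) := by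
        refine (spec_vec_aux _ _).2 ⟨v, hv0, ?_⟩
        ext u
        have := hpt u
        rw [h0] at this
        simp only [Pi.smul_apply, smul_eq_mul]
        field_simp
        linarith
      have h := hθd.2 hmem
      have h2 : x / c ≤ -θd := by linarith
      rw [div_le_iff₀ hc0] at h2
      linarith
    · have := mul_right_cancel₀ h0 hs
      linarith
  refine ⟨⟨M, hMs, hM1, hMx⟩, ?_⟩
  have hMh : ∀ N : Matrix V V ℝ, N.IsSymm → N.IsHermitian := by
    intro N hN
    rw [Matrix.IsHermitian, Matrix.conjTranspose_eq_transpose_of_trivial]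
    exact hN
  obtain ⟨i, hi⟩ := Finite.exists_max (hMh M hMs).eigenvalues
  have hgr : IsGreatest (spectrum ℝ M) ((hMh M hMs).eigenvalues i) := by
    rw [(hMh M hMs).spectrum_real_eq_range_eigenvalues]
    refine ⟨⟨i, rfl⟩, ?_⟩
    rintro _ ⟨j, rfl⟩
    exact hi j
  refine le_trans (csInf_le ⟨0, ?_⟩ ⟨M, hMs, hM1, hgr⟩) (hMx _ hgr.1)
  rintro r ⟨N, hN, hN1, hNr⟩
  by_contra hneg
  push Not at hneg
  have h1 := spec_trace_aux _ (hMh N hN)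
  have h2 : ∑ i, (hMh N hN).eigenvalues i < 0 := Finset.sum_neg
      (fun i _ => lt_of_le_of_lt (hNr.2 ((hMh N hN).eigenvalues_mem_spectrum_real i)) hneg)
      Finset.univ_nonempty
  have h3 : N.trace = n := by
    simp [Matrix.trace, hN1, hn]
  linarith
end

section
/- Let G be a connected graph on n vertices of diameter D ≥ 2, and suppose that the relation on V given by 'u = v or dist_G(u,v) = D' is an equivalence relation all of whose equivalence classes have exactly r elements, where r ≥ 2 (i.e., G is r-antipodal). Then the power graph G^{D−1} is a strongly regular graph with parameters (n, n−r; n−2r, n−r): it is (n−r)-regular, every two adjacent vertices have exactly n−2r common neighbours, and every two distinct nonadjacent vertices have exactly n−r common neighbours. -/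
open Polynomial

attribute [local instance] Classical.propDecidable

theorem stmt_8 {V : Type*} [Fintype V] (G : SimpleGraph V)
    (hconn : G.Connected) (n D r : ℕ) (hn : Fintype.card V = n)
    (hD2 : 2 ≤ D) (hr2 : 2 ≤ r)
    (hDle : ∀ u v : V, G.dist u v ≤ D)
    (hDeq : ∃ u v : V, G.dist u v = D)
    (hequiv : Equivalence (fun u v : V => u = v ∨ G.dist u v = D))
    (hclass : ∀ u : V, {v : V | u = v ∨ G.dist u v = D}.ncard = r) :
    (graphPower G (D - 1)).IsSRGWith n (n - r) (n - 2 * r) (n - r) := by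
  have hadj : ∀ u v : V, (graphPower G (D - 1)).Adj u v ↔ ¬ (u = v ∨ G.dist u v = D) := by
    intro u v
    have h1 := hDle u v
    have h2 : G.dist v u = G.dist u v := SimpleGraph.dist_comm
    simp only [graphPower, SimpleGraph.fromRel_adj, h2]
    constructor
    · rintro ⟨h, h'⟩ (h3 | h3)
      · exact h h3
      · omega
    · intro h
      push Not at h
      exact ⟨h.1, by omega⟩
  have hnb : ∀ u : V, (graphPower G (D - 1)).neighborSet u
      = {v : V | u = v ∨ G.dist u v = D}ᶜ := by
    intro u
    ext v
    simp only [SimpleGraph.mem_neighborSet, hadj, Set.mem_compl_iff, Set.mem_setOf_eq]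
  have hcard : ∀ s : Set V, sᶜ.ncard = n - s.ncard := by
    intro s
    rw [Set.ncard_compl, Nat.card_eq_fintype_card, hn]
  refine ⟨hn, ?_, ?_, ?_⟩
  · intro u
    rw [← SimpleGraph.card_neighborSet_eq_degree, ← Nat.card_eq_fintype_card,
      Nat.card_coe_set_eq, hnb, hcard, hclass]
  · intro u v h
    rw [hadj] at h
    rw [← Nat.card_eq_fintype_card, Nat.card_coe_set_eq, SimpleGraph.commonNeighbors,
      hnb, hnb, ← Set.compl_union, hcard, Set.ncard_union_eq _ (Set.toFinite _) (Set.toFinite _),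
      hclass, hclass, two_mul]
    rw [Set.disjoint_left]
    intro w hw hw'
    exact h (hequiv.trans hw (hequiv.symm hw'))
  · intro u v _ h
    rw [hadj, not_not] at h
    have : {w : V | v = w ∨ G.dist v w = D} = {w : V | u = w ∨ G.dist u w = D} := by
      ext w
      exact ⟨fun hw => hequiv.trans h hw, fun hw => hequiv.trans (hequiv.symm h) hw⟩
    rw [← Nat.card_eq_fintype_card, Nat.card_coe_set_eq, SimpleGraph.commonNeighbors,
      hnb, hnb, this, Set.inter_self, hcard, hclass]
end

section
/- Let G be a connected graph on n vertices of diameter D ≥ 2, and suppose that the relation on V given by 'u = v or dist_G(u,v) = D' is an equivalence relation all of whose equivalence classes have exactly r elements, where r ≥ 2. Then α(G^{D−1}) = r and, for every integer m ≥ 1, α((G^{D−1})^{⊠m}) = r^m; in particular the Shannon capacity Θ(G^{D−1}) equals r. -/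
open Polynomial

theorem indepNum_eq_aux {W : Type*} [Fintype W] (H : SimpleGraph W) (k : ℕ)
    (h1 : ∃ s : Finset W, s.card = k ∧ ∀ u ∈ s, ∀ v ∈ s, u ≠ v → ¬ H.Adj u v)
    (h2 : ∀ s : Finset W, (∀ u ∈ s, ∀ v ∈ s, u ≠ v → ¬ H.Adj u v) → s.card ≤ k) :
    indepNum H = k := by
  unfold indepNum
  apply IsGreatest.csSup_eq
  refine ⟨h1, ?_⟩
  rintro n ⟨s, rfl, hs⟩
  exact h2 s hs

theorem coloring_aux {V : Type*} [Fintype V] (R : V → V → Prop) (hR : Equivalence R) (r : ℕ)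
    (hclass : ∀ u : V, {v : V | R u v}.ncard = r) :
    ∃ c : V → Fin r, ∀ u v, R u v → c u = c v → u = v := by
  classical
  let S : Setoid V := ⟨R, hR⟩
  have e : ∀ u : V, Nonempty ({v : V | R u v} ≃ Fin r) := by
    intro u
    have h := hclass u
    rw [← Nat.card_coe_set_eq] at h
    exact ⟨Finite.equivFinOfCardEq h⟩
  replace e := fun u => Classical.choice (e u)
  let rep : V → V := fun v => (Quotient.mk S v).out
  have hrep : ∀ v, R (rep v) v := fun v => Quotient.exact (Quotient.out_eq (Quotient.mk S v))
  refine ⟨fun v => e (rep v) ⟨v, hrep v⟩, ?_⟩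
  intro u v huv h
  have hq : rep u = rep v := by
    have : Quotient.mk S u = Quotient.mk S v := Quotient.sound huv
    simp only [rep, this]
  have key : ∀ (a b : V) (ha : R a u) (hb : R b v), a = b → e a ⟨u, ha⟩ = e b ⟨v, hb⟩ → u = v := by
    intro a b ha hb hab h
    subst hab
    simpa using (e a).injective h
  exact key _ _ _ _ hq h

theorem stmt_9 {V : Type*} [Fintype V] (G : SimpleGraph V)
    (hconn : G.Connected) (n D r : ℕ) (hn : Fintype.card V = n)
    (hD2 : 2 ≤ D) (hr2 : 2 ≤ r)
    (hDle : ∀ u v : V, G.dist u v ≤ D)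
    (hDeq : ∃ u v : V, G.dist u v = D)
    (hequiv : Equivalence (fun u v : V => u = v ∨ G.dist u v = D))
    (hclass : ∀ u : V, {v : V | u = v ∨ G.dist u v = D}.ncard = r) :
    indepNum (graphPower G (D - 1)) = r ∧
    (∀ m : ℕ, 1 ≤ m → indepNum (strongPower (graphPower G (D - 1)) m) = r ^ m) ∧
    shannonCapacity (graphPower G (D - 1)) = (r : ℝ) := by
  have hadj : ∀ u v : V, (graphPower G (D - 1)).Adj u v ↔ ¬ (u = v ∨ G.dist u v = D) := by
    intro u v
    have h1 := hDle u v
    have h2 : G.dist v u = G.dist u v := SimpleGraph.dist_comm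
    simp only [graphPower, SimpleGraph.fromRel_adj, h2, or_self, not_or]
    constructor
    · rintro ⟨a, b⟩
      exact ⟨a, by omega⟩
    · rintro ⟨a, b⟩
      exact ⟨a, by omega⟩
  generalize graphPower G (D - 1) = H at hadj ⊢
  obtain ⟨c, hc⟩ := coloring_aux _ hequiv r hclass
  obtain ⟨u₀, -⟩ := hDeq
  classical
  let C : Finset V := Finset.univ.filter (fun v => u₀ = v ∨ G.dist u₀ v = D)
  have hCcard : C.card = r := by
    rw [← hclass u₀, ← Set.ncard_coe_finset]
    congr 1
    ext v
    simp [C]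
  have hCR : ∀ u ∈ C, ∀ v ∈ C, u = v ∨ G.dist u v = D := by
    intro u hu v hv
    exact hequiv.trans (hequiv.symm (Finset.mem_filter.1 hu).2) (Finset.mem_filter.1 hv).2
  have hpow : ∀ m : ℕ, 1 ≤ m → indepNum (strongPower H m) = r ^ m := by
    intro m _
    apply indepNum_eq_aux
    · refine ⟨Fintype.piFinset (fun _ : Fin m => C), by simp [hCcard], ?_⟩
      intro u hu v hv huv h
      rw [Fintype.mem_piFinset] at hu hv
      obtain ⟨-, h⟩ := (SimpleGraph.fromRel_adj _ _ _).1 h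
      apply huv
      funext j
      rcases h with h | h
      · rcases h j with h | h
        · exact h
        · exact absurd (hCR _ (hu j) _ (hv j)) ((hadj _ _).1 h)
      · rcases h j with h | h
        · exact h.symm
        · exact absurd (hCR _ (hv j) _ (hu j)) ((hadj _ _).1 h)
    · intro s hs
      have hinj : Set.InjOn (fun (u : Fin m → V) (j : Fin m) => c (u j)) (s : Set (Fin m → V)) := by
        intro u hu v hv huv
        by_contra hne
        apply hs u hu v hv hne
        refine (SimpleGraph.fromRel_adj _ _ _).2 ⟨hne, Or.inl ?_⟩
        intro j
        by_contra hj
        rw [hadj] at hj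
        push Not at hj
        exact hj.1 (hc _ _ (by tauto) (congrFun huv j))
      have := Finset.card_le_card_of_injOn (t := Finset.univ) _ (fun _ _ => Finset.mem_univ _) hinj
      simpa using this
  refine ⟨?_, hpow, ?_⟩
  · apply indepNum_eq_aux
    · exact ⟨C, hCcard, fun u hu v hv _ h => (hadj _ _).1 h (hCR u hu v hv)⟩
    · intro s hs
      have hinj : Set.InjOn c (s : Set V) := by
        intro u hu v hv huv
        by_contra hne
        have := hs u hu v hv hne
        rw [hadj, not_not] at this
        exact hne (hc _ _ this huv)
      have := Finset.card_le_card_of_injOn (t := Finset.univ) _ (fun _ _ => Finset.mem_univ _) hinj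
      simpa using this
  · unfold shannonCapacity
    have : ∀ m : ℕ+, (indepNum (strongPower H (m : ℕ)) : ℝ) ^ (((m : ℕ) : ℝ))⁻¹ = (r : ℝ) := by
      intro m
      rw [hpow m m.pos, Nat.cast_pow]
      exact Real.pow_rpow_inv_natCast (Nat.cast_nonneg r) m.pos.ne'
    simp only [this]
    exact ciSup_const
end

section
/- Let G be a finite simple graph and let B be a real matrix with rows and columns indexed by the vertices of G that fits G, i.e., B_{uu} ≠ 0 for every vertex u and B_{uv} = 0 whenever u ≠ v and u, v are nonadjacent in G. Then the independence number of G satisfies α(G) ≤ rank(B). -/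
open Polynomial

/-- A matrix `B` fits a graph `G` if all its diagonal entries are nonzero and
`B u v = 0` whenever `u ≠ v` and `u, v` are nonadjacent in `G`. -/
def Matrix.Fits {ι : Type*} (B : Matrix ι ι ℝ) (G : SimpleGraph ι) : Prop :=
  (∀ u, B u u ≠ 0) ∧ ∀ u v, u ≠ v → ¬ G.Adj u v → B u v = 0

theorem stmt_10 {V : Type*} [Fintype V] (G : SimpleGraph V)
    (B : Matrix V V ℝ) (hB : B.Fits G) :
    indepNum G ≤ B.rank := by
  classical
  apply csSup_le
  · exact ⟨0, ∅, by simp⟩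
  · rintro n ⟨s, rfl, hs⟩
    have h : B.submatrix (fun i : s => (i : V)) (fun i : s => (i : V))
        = Matrix.diagonal (fun i : s => B i i) := by
      ext i j
      by_cases hij : i = j
      · subst hij; simp
      · have hne : (i : V) ≠ j := fun h => hij (Subtype.ext h)
        rw [Matrix.diagonal_apply_ne _ hij]
        exact hB.2 _ _ hne (hs _ i.2 _ j.2 hne)
    have h2 := Matrix.rank_submatrix_le B (fun i : s => (i : V)) (fun i : s => (i : V))
    rw [h, Matrix.rank_of_isUnit] at h2
    · simpa using h2
    · rw [Matrix.isUnit_iff_isUnit_det, Matrix.det_diagonal, isUnit_iff_ne_zero]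
      exact Finset.prod_ne_zero_iff.2 fun i _ => hB.1 i
end

section
/- Let G be a finite simple graph and let B be a real matrix indexed by the vertices of G that fits G. Then for every integer m ≥ 1, the independence number of the m-th strong power of G satisfies α(G^{⊠m}) ≤ (rank B)^m; in particular the Shannon capacity of G is at most rank(B). -/
open Polynomial

theorem rank_fact_aux {V : Type*} [Fintype V] (B : Matrix V V ℝ) :
    ∃ (C : V → Fin B.rank → ℝ) (D : Fin B.rank → V → ℝ),
      ∀ u v, B u v = ∑ i, C u i * D i v := by
  classical
  let b : Module.Basis (Fin B.rank) ℝ (LinearMap.range B.mulVecLin) :=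
    Module.finBasisOfFinrankEq ℝ _ rfl
  let x : V → LinearMap.range B.mulVecLin := fun v =>
    ⟨B.mulVecLin (Pi.single v 1), LinearMap.mem_range_self _ _⟩
  refine ⟨fun u i => (b i : V → ℝ) u, fun i v => b.repr (x v) i, fun u v => ?_⟩
  have h := congrArg (fun y : LinearMap.range B.mulVecLin => (y : V → ℝ) u) (b.sum_repr (x v))
  simp only [Submodule.coe_sum, Submodule.coe_smul, Finset.sum_apply, Pi.smul_apply,
    smul_eq_mul] at h
  have hx : (x v : V → ℝ) u = B u v := by
    simp [x]
  rw [← hx, ← h]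
  exact Finset.sum_congr rfl fun i _ => mul_comm _ _

theorem indep_aux {V : Type*} [Fintype V] (G : SimpleGraph V)
    (B : Matrix V V ℝ) (hB : B.Fits G) (m : ℕ) :
    indepNum (strongPower G m) ≤ B.rank ^ m := by
  classical
  refine csSup_le' ?_
  rintro n ⟨s, rfl, hs⟩
  obtain ⟨C, D, hCD⟩ := rank_fact_aux B
  let P : Matrix s (Fin m → Fin B.rank) ℝ := fun u f => ∏ j, C (u.1 j) (f j)
  let Q : Matrix (Fin m → Fin B.rank) s ℝ := fun f v => ∏ j, D (f j) (v.1 j)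
  have hM : P * Q = Matrix.diagonal (fun u : s => ∏ j, B (u.1 j) (u.1 j)) := by
    ext u v
    have h1 : (P * Q) u v = ∏ j, B (u.1 j) (v.1 j) := by
      rw [Matrix.mul_apply]
      simp only [hCD, P, Q, Finset.prod_univ_sum, Fintype.piFinset_univ,
        Finset.prod_mul_distrib]
    rw [h1]
    by_cases huv : u = v
    · subst huv
      simp
    · rw [Matrix.diagonal_apply_ne _ huv]
      have hne : u.1 ≠ v.1 := fun h => huv (Subtype.ext h)
      have h2 := hs u.1 u.2 v.1 v.2 hne
      have h3 : ¬ ∀ j, u.1 j = v.1 j ∨ G.Adj (u.1 j) (v.1 j) := fun h =>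
        h2 (by
          rw [strongPower, SimpleGraph.fromRel_adj]
          exact ⟨hne, Or.inl h⟩)
      push Not at h3
      obtain ⟨j, hj1, hj2⟩ := h3
      exact Finset.prod_eq_zero (Finset.mem_univ j) (hB.2 _ _ hj1 hj2)
  have hr : (P * Q).rank = s.card := by
    rw [Matrix.rank_of_det_ne_zero, Fintype.card_coe]
    rw [hM, Matrix.det_diagonal]
    exact Finset.prod_ne_zero_iff.2 fun u _ => Finset.prod_ne_zero_iff.2 fun j _ => hB.1 _
  rw [← hr]
  refine (Matrix.rank_mul_le_left P Q).trans ((Matrix.rank_le_card_width P).trans ?_)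
  simp

theorem stmt_12 {V : Type*} [Fintype V] (G : SimpleGraph V)
    (B : Matrix V V ℝ) (hB : B.Fits G) :
    (∀ m : ℕ, 1 ≤ m → indepNum (strongPower G m) ≤ B.rank ^ m) ∧
    shannonCapacity G ≤ (B.rank : ℝ) := by
  refine ⟨fun m _ => indep_aux G B hB m, ?_⟩
  refine ciSup_le fun m => ?_
  have hm : ((m : ℕ) : ℝ) ≠ 0 := by exact_mod_cast m.ne_zero
  have h : (indepNum (strongPower G (m : ℕ)) : ℝ) ≤ (B.rank : ℝ) ^ (m : ℕ) := by
    exact_mod_cast indep_aux G B hB m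
  refine (Real.rpow_le_rpow (Nat.cast_nonneg _) h (by positivity)).trans ?_
  rw [Real.pow_rpow_inv_natCast (Nat.cast_nonneg _) m.ne_zero]
end

section
/- Let G be a finite simple connected graph with adjacency matrix A, let k ≥ 1, and let p be a real polynomial of degree at most k such that (p(A))_{uu} ≠ 0 for every vertex u. Then the k-independence number satisfies α_k(G) = α(G^k) ≤ rank(p(A)). -/
open Polynomial

theorem stmt_13 {V : Type*} [Fintype V] [DecidableEq V]
    (G : SimpleGraph V) [DecidableRel G.Adj]
    (hconn : G.Connected) (k : ℕ) (hk : 1 ≤ k)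
    (p : ℝ[X]) (hdeg : p.natDegree ≤ k)
    (hdiag : ∀ u : V, (Polynomial.aeval (G.adjMatrix ℝ) p) u u ≠ 0) :
    indepNum (graphPower G k) ≤ (Polynomial.aeval (G.adjMatrix ℝ) p).rank := by
  unfold indepNum
  apply csSup_le'
  rintro n ⟨s, rfl, hs⟩
  set M := Polynomial.aeval (G.adjMatrix ℝ) p with hM
  have hoff : ∀ u ∈ s, ∀ v ∈ s, u ≠ v → M u v = 0 := by
    intro u hu v hv huv
    have h1 := hs u hu v hv huv
    have hd : k < G.dist u v := by
      by_contra hcon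
      apply h1
      rw [graphPower, SimpleGraph.fromRel_adj]
      exact ⟨huv, Or.inl (not_lt.mp hcon)⟩
    rw [hM, Polynomial.aeval_eq_sum_range, Matrix.sum_apply]
    apply Finset.sum_eq_zero
    intro i hi
    have hi' : i ≤ k := by
      have := Finset.mem_range.mp hi
      omega
    rw [Matrix.smul_apply, SimpleGraph.adjMatrix_pow_apply_eq_card_walk]
    have : Fintype.card { q : G.Walk u v | q.length = i } = 0 := by
      rw [Fintype.card_eq_zero_iff]
      refine ⟨fun q => ?_⟩
      have h2 : q.1.length = i := q.2
      have h3 := SimpleGraph.dist_le q.1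
      omega
    rw [this]
    simp
  have hsub : M.submatrix (fun x : s => (x : V)) (fun x : s => (x : V))
      = Matrix.diagonal (fun x : s => M x x) := by
    ext a b
    by_cases hab : a = b
    · subst hab
      simp
    · rw [Matrix.diagonal_apply_ne _ hab, Matrix.submatrix_apply]
      exact hoff a a.2 b b.2 (fun h => hab (Subtype.ext h))
  have hrank : (Matrix.diagonal (fun x : s => M x x)).rank = s.card := by
    rw [Matrix.rank_of_isUnit]
    · simp
    · rw [Matrix.isUnit_iff_isUnit_det, Matrix.det_diagonal, isUnit_iff_ne_zero]
      exact Finset.prod_ne_zero_iff.mpr fun x _ => hdiag x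
  rw [← hrank, ← hsub]
  exact Matrix.rank_submatrix_le _ _ _
end

section
/- Let G be a finite simple connected graph with adjacency matrix A, let k ≥ 1, and let p be a real polynomial of degree at most k such that (p(A))_{uu} ≠ 0 for every vertex u. Then for every integer m ≥ 1, the independence number of the m-th strong power of G^k satisfies α((G^k)^{⊠m}) ≤ (rank p(A))^m; in particular the Shannon capacity of G^k is at most rank(p(A)). -/
open Polynomial

theorem aux_factor {V : Type*} [Fintype V] [DecidableEq V] (M : Matrix V V ℝ) :
    ∃ (B : V → Fin M.rank → ℝ) (C : Fin M.rank → V → ℝ),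
      ∀ u v, M u v = ∑ i, B u i * C i v := by
  let b : Module.Basis (Fin M.rank) ℝ (LinearMap.range M.mulVecLin) :=
    Module.finBasisOfFinrankEq ℝ _ rfl
  refine ⟨fun u i => (b i : V → ℝ) u,
    fun i v => b.repr ⟨M.mulVecLin (Pi.single v 1), LinearMap.mem_range_self _ _⟩ i, ?_⟩
  intro u v
  have h := b.sum_repr ⟨M.mulVecLin (Pi.single v 1), LinearMap.mem_range_self _ _⟩
  have h2 := congrFun (congrArg Subtype.val h) u
  simp only [Submodule.coe_sum, Submodule.coe_smul, Finset.sum_apply, Pi.smul_apply,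
    smul_eq_mul, Matrix.mulVecLin_apply, Matrix.mulVec_single_one, Matrix.col_apply] at h2
  rw [← h2]
  exact Finset.sum_congr rfl fun i _ => by simp [mul_comm]

theorem aux_zero {V : Type*} [Fintype V] [DecidableEq V]
    (G : SimpleGraph V) [DecidableRel G.Adj] (k : ℕ)
    (p : ℝ[X]) (hdeg : p.natDegree ≤ k) (u v : V) (h : k < G.dist u v) :
    (Polynomial.aeval (G.adjMatrix ℝ) p) u v = 0 := by
  rw [Polynomial.aeval_eq_sum_range, Matrix.sum_apply]
  refine Finset.sum_eq_zero fun i hi => ?_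
  rw [Matrix.smul_apply, SimpleGraph.adjMatrix_pow_apply_eq_card_walk]
  have : IsEmpty {w : G.Walk u v | w.length = i} := by
    refine ⟨fun w => ?_⟩
    have h1 := SimpleGraph.dist_le w.1
    have h2 : w.1.length = i := w.2
    have := Finset.mem_range.1 hi
    omega
  simp

theorem aux_bound_s14 {V : Type*} [Fintype V] [DecidableEq V] (M : Matrix V V ℝ)
    (H : SimpleGraph V) (hd : ∀ u, M u u ≠ 0)
    (hz : ∀ u v, u ≠ v → ¬ H.Adj u v → M u v = 0) (m : ℕ) :
    indepNum (strongPower H m) ≤ M.rank ^ m := by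
  obtain ⟨B, C, hBC⟩ := aux_factor M
  refine csSup_le ⟨0, ∅, by simp⟩ ?_
  rintro n ⟨s, rfl, hs⟩
  let P : Matrix s (Fin m → Fin M.rank) ℝ := fun u f => ∏ j, B (u.1 j) (f j)
  let Q : Matrix (Fin m → Fin M.rank) s ℝ := fun f v => ∏ j, C (f j) (v.1 j)
  have hPQ : P * Q = Matrix.diagonal fun u : s => ∏ j, M (u.1 j) (u.1 j) := by
    ext u v
    have h1 : (P * Q) u v = ∏ j, M (u.1 j) (v.1 j) := by
      rw [Matrix.mul_apply]
      simp only [P, Q, hBC, ← Finset.prod_mul_distrib]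
      rw [Finset.prod_univ_sum, Fintype.piFinset_univ]
    rw [h1]
    by_cases huv : u = v
    · subst huv; simp
    · rw [Matrix.diagonal_apply_ne _ huv]
      have hne : u.1 ≠ v.1 := fun h => huv (Subtype.ext h)
      have h2 := hs _ u.2 _ v.2 hne
      simp only [strongPower, SimpleGraph.fromRel_adj, not_and, not_or] at h2
      have h3 := (h2 hne).1
      push Not at h3
      obtain ⟨j, hj1, hj2⟩ := h3
      exact Finset.prod_eq_zero (Finset.mem_univ j) (hz _ _ hj1 hj2)
  have hr : (P * Q).rank = s.card := by
    rw [hPQ, Matrix.rank_of_isUnit]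
    · simp
    · rw [Matrix.isUnit_iff_isUnit_det, Matrix.det_diagonal, isUnit_iff_ne_zero]
      exact Finset.prod_ne_zero_iff.2 fun u _ => Finset.prod_ne_zero_iff.2 fun j _ => hd _
  calc s.card = (P * Q).rank := hr.symm
    _ ≤ P.rank := Matrix.rank_mul_le_left _ _
    _ ≤ Fintype.card (Fin m → Fin M.rank) := Matrix.rank_le_card_width _
    _ = _ := by simp

theorem stmt_14 {V : Type*} [Fintype V] [DecidableEq V]
    (G : SimpleGraph V) [DecidableRel G.Adj]
    (hconn : G.Connected) (k : ℕ) (hk : 1 ≤ k)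
    (p : ℝ[X]) (hdeg : p.natDegree ≤ k)
    (hdiag : ∀ u : V, (Polynomial.aeval (G.adjMatrix ℝ) p) u u ≠ 0) :
    (∀ m : ℕ, 1 ≤ m →
      indepNum (strongPower (graphPower G k) m) ≤
        (Polynomial.aeval (G.adjMatrix ℝ) p).rank ^ m) ∧
    shannonCapacity (graphPower G k) ≤ ((Polynomial.aeval (G.adjMatrix ℝ) p).rank : ℝ) := by
  have key : ∀ m : ℕ, indepNum (strongPower (graphPower G k) m) ≤
        (Polynomial.aeval (G.adjMatrix ℝ) p).rank ^ m := by
    refine aux_bound_s14 _ _ hdiag ?_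
    intro u v huv hadj
    apply aux_zero G k p hdeg
    by_contra hc
    exact hadj ((SimpleGraph.fromRel_adj _ _ _).2 ⟨huv, Or.inl (not_lt.1 hc)⟩)
  refine ⟨fun m _ => key m, ?_⟩
  refine ciSup_le fun m => ?_
  have hm : ((m : ℕ) : ℝ) ≠ 0 := by exact_mod_cast m.ne_zero
  rw [Real.rpow_inv_le_iff_of_pos (by positivity) (by positivity)
    (by exact_mod_cast m.pos), Real.rpow_natCast]
  exact_mod_cast key m
end

section
/- Let G be a connected k-partially walk-regular graph on n vertices with adjacency matrix A, distinct eigenvalues θ_0 > θ_1 > ⋯ > θ_d and multiplicities m_0, m_1, …, m_d, and let p be a real polynomial of degree at most k with tr p(A) ≠ 0. Then rank p(A) = Σ_{i : p(θ_i) ≠ 0} m_i and, for every integer m ≥ 1, α((G^k)^{⊠m}) ≤ (Σ_{i : p(θ_i) ≠ 0} m_i)^m; in particular the Shannon capacity of G^k is at most the number of eigenvalues of A, counted with multiplicity, at which p does not vanish. -/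
open Polynomial

theorem aux_decomp_s15 {V : Type*} [Fintype V] [DecidableEq V] (A : Matrix V V ℝ)
    (hA : A.IsHermitian) (p : ℝ[X]) :
    Polynomial.aeval A p = (hA.eigenvectorUnitary : Matrix V V ℝ) *
      Matrix.diagonal (fun i => p.eval (hA.eigenvalues i)) *
        (star hA.eigenvectorUnitary : Matrix.unitaryGroup V ℝ) := by
  have h1 : Polynomial.aeval A p = Unitary.conjStarAlgAut ℝ _ hA.eigenvectorUnitary
      (Polynomial.aeval (Matrix.diagonal hA.eigenvalues) p) := by
    conv_lhs => rw [hA.spectral_theorem]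
    exact Polynomial.aeval_algHom_apply (Unitary.conjStarAlgAut ℝ _ hA.eigenvectorUnitary) _ p
  have h2 : Polynomial.aeval (Matrix.diagonal hA.eigenvalues) p =
      Matrix.diagonal (fun i => p.eval (hA.eigenvalues i)) := by
    have := Polynomial.aeval_algHom_apply (Matrix.diagonalAlgHom (n := V) (α := ℝ) ℝ)
      hA.eigenvalues p
    simp only [Matrix.diagonalAlgHom_apply] at this
    rw [this]
    congr 1
    ext i
    rw [Polynomial.aeval_pi_apply]
    simp [Polynomial.aeval_def, Polynomial.eval₂_eq_eval_map]
  rw [h1, h2, Unitary.conjStarAlgAut_apply]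
  rfl

theorem aux_rank {V : Type*} [Fintype V] [DecidableEq V] (A : Matrix V V ℝ)
    (hA : A.IsHermitian) (p : ℝ[X]) :
    (Polynomial.aeval A p).rank = Fintype.card {i // p.eval (hA.eigenvalues i) ≠ 0} := by
  rw [aux_decomp_s15 A hA p]
  simp [-isUnit_iff_ne_zero, -Unitary.coe_star, Matrix.rank_diagonal]

theorem aux_count {V : Type*} [Fintype V] [DecidableEq V] (A : Matrix V V ℝ)
    (hA : A.IsHermitian) (p : ℝ[X]) (d : ℕ) (θ : Fin (d + 1) → ℝ) (mult : Fin (d + 1) → ℕ)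
    (hchar : A.charpoly = ∏ i : Fin (d + 1), (X - C (θ i)) ^ (mult i)) :
    Fintype.card {i // p.eval (hA.eigenvalues i) ≠ 0} =
      ∑ i ∈ Finset.univ.filter (fun i : Fin (d + 1) => p.eval (θ i) ≠ 0), mult i := by
  have h1 := hA.roots_charpoly_eq_eigenvalues
  rw [hchar, Polynomial.roots_prod _ _ (by
    simp [Finset.prod_ne_zero_iff, Polynomial.X_sub_C_ne_zero])] at h1
  have h2 := congrArg (Multiset.countP (fun x => p.eval x ≠ 0)) h1
  rw [Multiset.countP_map, ← Finset.filter_val, Finset.card_val] at h2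
  rw [Fintype.card_subtype]
  refine Eq.trans h2.symm ?_
  simp only [Multiset.bind, Multiset.join, Polynomial.roots_pow, Polynomial.roots_X_sub_C]
  change Multiset.countPAddMonoidHom _ (∑ i, _) = _
  rw [map_sum, Finset.sum_filter]
  refine Finset.sum_congr rfl fun i _ => ?_
  simp only [map_nsmul, Multiset.coe_countPAddMonoidHom]
  by_cases h : p.eval (θ i) = 0 <;> simp [h, ← Multiset.cons_zero]

theorem aux_factor_s15 {V : Type*} [Fintype V] [DecidableEq V] (A : Matrix V V ℝ)
    (hA : A.IsHermitian) (p : ℝ[X]) :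
    ∃ (B D : V → {i // p.eval (hA.eigenvalues i) ≠ 0} → ℝ), ∀ u v,
      Polynomial.aeval A p u v = ∑ i, B u i * D v i := by
  refine ⟨fun u i => (hA.eigenvectorUnitary : Matrix V V ℝ) u i * p.eval (hA.eigenvalues i),
    fun v i => (star hA.eigenvectorUnitary : Matrix.unitaryGroup V ℝ).1 i v, fun u v => ?_⟩
  conv_lhs => rw [aux_decomp_s15 A hA p]
  rw [Matrix.mul_apply]
  simp only [Matrix.mul_diagonal]
  rw [← Finset.sum_subtype (p := fun i => p.eval (hA.eigenvalues i) ≠ 0)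
    (Finset.univ.filter (fun i => p.eval (hA.eigenvalues i) ≠ 0)) (by simp)
    (fun i => (hA.eigenvectorUnitary : Matrix V V ℝ) u i * p.eval (hA.eigenvalues i) *
      (star hA.eigenvectorUnitary : Matrix.unitaryGroup V ℝ).1 i v)]
  symm
  apply Finset.sum_subset (Finset.subset_univ _)
  intro i _ hi
  have h0 : p.eval (hA.eigenvalues i) = 0 := by simpa using hi
  rw [h0, mul_zero, zero_mul]

theorem aux_indep_s15 {V ι : Type*} [Fintype V] [Fintype ι] [DecidableEq ι] (H : SimpleGraph V)
    (M : V → V → ℝ)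
    (B D : V → ι → ℝ) (hM : ∀ u v, M u v = ∑ i, B u i * D v i)
    (hdiag : ∀ u, M u u ≠ 0) (hoff : ∀ u v, u ≠ v → ¬ H.Adj u v → M u v = 0) (m : ℕ) :
    indepNum (strongPower H m) ≤ Fintype.card ι ^ m := by
  classical
  refine csSup_le ⟨0, ∅, by simp⟩ ?_
  rintro _ ⟨s, rfl, hs⟩
  let P : Matrix s (Fin m → ι) ℝ := Matrix.of fun u f => ∏ j, B (u.1 j) (f j)
  let Q : Matrix (Fin m → ι) s ℝ := Matrix.of fun f v => ∏ j, D (v.1 j) (f j)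
  have hPQ : P * Q = Matrix.diagonal fun u : s => ∏ j, M (u.1 j) (u.1 j) := by
    ext u v
    have e : (P * Q) u v = ∏ j, M (u.1 j) (v.1 j) := by
      simp only [Matrix.mul_apply, P, Q, Matrix.of_apply, hM, ← Finset.prod_mul_distrib]
      rw [Finset.prod_univ_sum]
      simp
    rw [e]
    by_cases huv : u = v
    · subst huv; simp
    · rw [Matrix.diagonal_apply_ne _ huv]
      have hne : u.1 ≠ v.1 := fun h => huv (Subtype.ext h)
      have := hs u.1 u.2 v.1 v.2 hne
      simp only [strongPower, SimpleGraph.fromRel_adj, not_and, not_or, not_forall] at this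
      obtain ⟨j, hj⟩ := (this hne).1
      exact Finset.prod_eq_zero (Finset.mem_univ j) (hoff _ _ hj.1 hj.2)
  have h1 : (P * Q).rank = s.card := by
    rw [hPQ, Matrix.rank_diagonal, Fintype.card_subtype, Finset.filter_true_of_mem]
    · simp
    · intro u _
      exact Finset.prod_ne_zero_iff.2 fun j _ => hdiag _
  have h2 := (Matrix.rank_mul_le_left P Q).trans (Matrix.rank_le_card_width P)
  rw [h1] at h2
  simpa using h2

attribute [local instance] Classical.propDecidable

theorem stmt_15 {V : Type*} [Fintype V] [DecidableEq V]
    (G : SimpleGraph V) [DecidableRel G.Adj]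
    (hconn : G.Connected) (n d k : ℕ) (hn : Fintype.card V = n)
    (hwr : ∀ ℓ : ℕ, ℓ ≤ k → ∀ u v : V,
      ((G.adjMatrix ℝ) ^ ℓ) u u = ((G.adjMatrix ℝ) ^ ℓ) v v)
    (θ : Fin (d + 1) → ℝ) (hanti : StrictAnti θ)
    (mult : Fin (d + 1) → ℕ)
    (hchar : (G.adjMatrix ℝ).charpoly = ∏ i : Fin (d + 1), (X - C (θ i)) ^ (mult i))
    (p : ℝ[X]) (hdeg : p.natDegree ≤ k)
    (htr : (Polynomial.aeval (G.adjMatrix ℝ) p).trace ≠ 0) :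
    (Polynomial.aeval (G.adjMatrix ℝ) p).rank =
      ∑ i ∈ Finset.univ.filter (fun i : Fin (d + 1) => p.eval (θ i) ≠ 0), mult i ∧
    (∀ m : ℕ, 1 ≤ m →
      indepNum (strongPower (graphPower G k) m) ≤
        (∑ i ∈ Finset.univ.filter (fun i : Fin (d + 1) => p.eval (θ i) ≠ 0), mult i) ^ m) ∧
    shannonCapacity (graphPower G k) ≤
      ((∑ i ∈ Finset.univ.filter (fun i : Fin (d + 1) => p.eval (θ i) ≠ 0), mult i : ℕ) : ℝ) := by
  have hA : (G.adjMatrix ℝ).IsHermitian := by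
    rw [Matrix.IsHermitian, Matrix.conjTranspose_eq_transpose_of_trivial]
    exact G.isSymm_adjMatrix
  have hc : ∀ i : DecidablePred fun i => p.eval (hA.eigenvalues i) ≠ 0,
      Fintype.card {i // p.eval (hA.eigenvalues i) ≠ 0} =
      ∑ i ∈ Finset.univ.filter (fun i : Fin (d + 1) => p.eval (θ i) ≠ 0), mult i := by
    intro _
    convert aux_count _ hA p d θ mult hchar
  have happ : ∀ u v, Polynomial.aeval (G.adjMatrix ℝ) p u v =
      ∑ i ∈ Finset.range (p.natDegree + 1), p.coeff i * ((G.adjMatrix ℝ) ^ i) u v := by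
    intro u v
    rw [Polynomial.aeval_eq_sum_range, Matrix.sum_apply]
    simp
  have hconst : ∀ u v, Polynomial.aeval (G.adjMatrix ℝ) p u u =
      Polynomial.aeval (G.adjMatrix ℝ) p v v := by
    intro u v
    rw [happ, happ]
    refine Finset.sum_congr rfl fun i hi => ?_
    rw [hwr i (by have := Finset.mem_range.1 hi; omega) u v]
  have hdiag : ∀ u, Polynomial.aeval (G.adjMatrix ℝ) p u u ≠ 0 := by
    intro u h0
    apply htr
    rw [Matrix.trace]
    refine Finset.sum_eq_zero fun v _ => ?_
    rw [Matrix.diag_apply, hconst v u, h0]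
  have hoff : ∀ u v, u ≠ v → ¬ (graphPower G k).Adj u v →
      Polynomial.aeval (G.adjMatrix ℝ) p u v = 0 := by
    intro u v huv hadj
    simp only [graphPower, SimpleGraph.fromRel_adj, not_and, not_or, not_le] at hadj
    have hd := (hadj huv).1
    rw [happ]
    refine Finset.sum_eq_zero fun i hi => ?_
    have hi' := Finset.mem_range.1 hi
    rw [SimpleGraph.adjMatrix_pow_apply_eq_card_walk, Fintype.card_eq_zero_iff.2]
    · simp
    · refine ⟨fun w => ?_⟩
      have h1 := SimpleGraph.dist_le w.1
      have h2 : w.1.length = i := w.2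
      omega
  obtain ⟨B, D, hBD⟩ := aux_factor_s15 _ hA p
  have hα : ∀ m : ℕ, indepNum (strongPower (graphPower G k) m) ≤
        (∑ i ∈ Finset.univ.filter (fun i : Fin (d + 1) => p.eval (θ i) ≠ 0), mult i) ^ m := by
    intro m
    rw [← hc inferInstance]
    convert aux_indep_s15 (graphPower G k) _ B D hBD hdiag hoff m
  refine ⟨?_, fun m _ => hα m, ?_⟩
  · rw [← hc inferInstance, aux_rank _ hA p]
  · refine ciSup_le fun m => ?_
    refine (Real.rpow_le_rpow (by positivity) (Nat.cast_le.2 (hα m)) (by positivity)).trans ?_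
    rw [Nat.cast_pow, Real.pow_rpow_inv_natCast (by positivity) m.ne_zero]
end

section
/- Let G be a δ-regular graph with girth g ≥ 3 and adjacency matrix A. Then G is 2⌊(g−1)/2⌋-partially walk-regular: for every integer ℓ with 0 ≤ ℓ ≤ 2⌊(g−1)/2⌋ and all vertices u, v, one has (A^ℓ)_{uu} = (A^ℓ)_{vv}. -/
namespace Stmt17

open SimpleGraph

theorem path_unique_of_lt_girth {V : Type*} (G : SimpleGraph V) (g : ℕ)
    (hg : (g : ℕ∞) ≤ G.egirth) {u v : V} (p q : G.Walk u v) (hp : p.IsPath) (hq : q.IsPath)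
    (hl : p.length + q.length < g) : p = q := by
  classical
  let H : SimpleGraph V := SimpleGraph.fromEdgeSet {e | e ∈ p.edges ++ q.edges}
  have hHle : ∀ e ∈ H.edgeSet, e ∈ p.edges ++ q.edges := by
    intro e he
    simp only [H, edgeSet_fromEdgeSet] at he
    exact he.1
  have hHG : H ≤ G := by
    rw [← SimpleGraph.edgeSet_subset_edgeSet]
    intro e he
    rcases List.mem_append.1 (hHle e he) with h | h
    · exact p.edges_subset_edgeSet h
    · exact q.edges_subset_edgeSet h
  have hpH : ∀ e ∈ p.edges, e ∈ H.edgeSet := by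
    intro e he
    simp only [H, edgeSet_fromEdgeSet]
    exact ⟨List.mem_append_left _ he, G.not_isDiag_of_mem_edgeSet (p.edges_subset_edgeSet he)⟩
  have hqH : ∀ e ∈ q.edges, e ∈ H.edgeSet := by
    intro e he
    simp only [H, edgeSet_fromEdgeSet]
    exact ⟨List.mem_append_right _ he, G.not_isDiag_of_mem_edgeSet (q.edges_subset_edgeSet he)⟩
  have hac : H.IsAcyclic := by
    intro a c hc
    have h1 : c.edges.length ≤ (p.edges ++ q.edges).length := by
      apply List.Subperm.length_le
      exact hc.edges_nodup.subperm (fun e he => hHle e (c.edges_subset_edgeSet he))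
    have h2 := SimpleGraph.egirth_le_length (hc.mapLe hHG)
    have h3 := hg.trans h2
    simp at h1 h3
    omega
  have := (hac.subsingleton_path u v).elim
    ⟨p.transfer H hpH, hp.transfer hpH⟩ ⟨q.transfer H hqH, hq.transfer hqH⟩
  have h4 : p.transfer H hpH = q.transfer H hqH := congrArg Subtype.val this
  have h5 := congrArg Walk.support h4
  rw [Walk.support_transfer, Walk.support_transfer] at h5
  exact Walk.ext_support h5

theorem dist_nbr {V : Type*} (G : SimpleGraph V) (g : ℕ)
    (hg : (g : ℕ∞) ≤ G.egirth) {u v w : V} (p : G.Walk u v) (hp : p.IsPath)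
    (hpl : p.length = G.dist u v) (k : ℕ) (hk : k ≤ 1) (hl : 2 * G.dist u v + k < g)
    (hw : G.Adj u w) (hne : w ≠ p.snd) :
    G.dist u v + k ≤ G.dist w v ∧ G.dist w v ≤ G.dist u v + 1 := by
  have hr : G.Reachable w v := hw.symm.reachable.trans p.reachable
  have hle : G.dist w v ≤ G.dist u v + 1 := by
    rw [← hpl]
    exact SimpleGraph.dist_le (Walk.cons hw.symm p)
  refine ⟨?_, hle⟩
  by_contra hcon
  have hlt : G.dist w v ≤ G.dist u v := by omega
  obtain ⟨r, hr, hrl⟩ := hr.exists_path_of_dist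
  classical
  have hu : u ∉ r.support := by
    intro hu
    have h1 : G.dist u v ≤ (r.dropUntil u hu).length := SimpleGraph.dist_le _
    have h2 := congrArg Walk.length (r.take_spec hu)
    rw [Walk.length_append] at h2
    have h3 : (r.takeUntil u hu).length = 0 := by omega
    exact hw.ne (Walk.eq_of_length_eq_zero h3).symm
  have h := path_unique_of_lt_girth G g hg p (Walk.cons hw r) hp (hr.cons hu) (by
    rw [Walk.length_cons]; omega)
  apply hne
  rw [h]
  simp

def c (δ : ℕ) : ℕ → ℕ → ℝ
  | 0, 0 => 1
  | 0, _ + 1 => 0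
  | l + 1, 0 => δ * c δ l 1
  | l + 1, d + 1 => c δ l d + (δ - 1) * c δ l (d + 2)

theorem c_zero (δ : ℕ) : ∀ l d : ℕ, l < d → c δ l d = 0 := by
  intro l
  induction l with
  | zero => intro d h; cases d with
    | zero => omega
    | succ d => simp [c]
  | succ l ih => intro d h; cases d with
    | zero => omega
    | succ d => simp [c, ih d (by omega), ih (d + 2) (by omega)]

theorem main {V : Type*} [Fintype V] [DecidableEq V]
    (G : SimpleGraph V) [DecidableRel G.Adj] (δ g : ℕ)
    (hreg : G.IsRegularOfDegree δ) (hg : (g : ℕ∞) ≤ G.egirth) (l : ℕ) :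
    ∀ u v : V, G.Reachable u v → l + G.dist u v < g →
      ((G.adjMatrix ℝ) ^ l) u v = c δ l (G.dist u v) := by
  induction l with
  | zero =>
    intro u v hr _
    by_cases h : u = v
    · subst h; simp [c]
    · have := hr.pos_dist_of_ne h
      rw [c_zero δ 0 _ this]
      simp [h]
  | succ l ih =>
    intro u v hr hl
    by_cases hd : l + 1 < G.dist u v
    · rw [c_zero _ _ _ hd, SimpleGraph.adjMatrix_pow_apply_eq_card_walk]
      rw [Nat.cast_eq_zero, Fintype.card_eq_zero_iff]
      constructor
      rintro ⟨p, hp⟩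
      have := SimpleGraph.dist_le p
      simp at hp
      omega
    · rw [pow_succ', SimpleGraph.adjMatrix_mul_apply]
      by_cases h : u = v
      · subst h
        rw [SimpleGraph.dist_self] at hl ⊢
        have : ∀ w ∈ G.neighborFinset u, ((G.adjMatrix ℝ) ^ l) w u = c δ l 1 := by
          intro w hw
          rw [mem_neighborFinset] at hw
          have h1 : G.dist w u = 1 := SimpleGraph.dist_eq_one_iff_adj.2 hw.symm
          rw [ih w u hw.symm.reachable (by omega), h1]
        rw [Finset.sum_congr rfl this]
        simp [c, hreg.degree_eq u]
      · obtain ⟨p, hp, hpl⟩ := hr.exists_path_of_dist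
        have hpos := hr.pos_dist_of_ne h
        have hnn : ¬ p.Nil := by
          intro hn; exact h hn.eq
        have hadj := p.adj_snd hnn
        have hmem : p.snd ∈ G.neighborFinset u := by
          rw [mem_neighborFinset]; exact hadj
        obtain ⟨d, hdd⟩ : ∃ d, G.dist u v = d + 1 := ⟨G.dist u v - 1, by omega⟩
        have hs : G.dist p.snd v = d := by
          have h1 : G.dist p.snd v ≤ p.tail.length := SimpleGraph.dist_le _
          have h2 := Walk.length_tail_add_one hnn
          obtain ⟨r, hr'⟩ := p.tail.reachable.exists_walk_length_eq_dist
          have h3 := SimpleGraph.dist_le (Walk.cons hadj r)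
          rw [Walk.length_cons] at h3
          omega
        rw [← Finset.add_sum_erase _ _ hmem]
        have : ∀ w ∈ (G.neighborFinset u).erase p.snd,
            ((G.adjMatrix ℝ) ^ l) w v = c δ l (d + 2) := by
          intro w hw
          rw [Finset.mem_erase, mem_neighborFinset] at hw
          by_cases hdl : d = l
          · have h1 := dist_nbr G g hg p hp hpl 0 (by omega) (by omega) hw.2 hw.1
            rw [c_zero δ l (d + 2) (by omega),
              SimpleGraph.adjMatrix_pow_apply_eq_card_walk, Nat.cast_eq_zero,
              Fintype.card_eq_zero_iff]
            constructor
            rintro ⟨q, hq⟩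
            have := SimpleGraph.dist_le q
            simp at hq
            omega
          · have h1 := dist_nbr G g hg p hp hpl 1 (by omega) (by omega) hw.2 hw.1
            have h2 : G.dist w v = d + 2 := by omega
            rw [ih w v (hw.2.symm.reachable.trans hr) (by omega), h2]
        rw [Finset.sum_congr rfl this, ih _ v p.tail.reachable (by omega), hs, hdd,
          Finset.sum_const, Finset.card_erase_of_mem hmem, card_neighborFinset_eq_degree,
          hreg.degree_eq u]
        have hδ : 1 ≤ δ := by
          rw [← hreg.degree_eq u, ← card_neighborFinset_eq_degree]
          exact Finset.card_pos.2 ⟨_, hmem⟩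
        simp [c, Nat.cast_sub hδ]

end Stmt17

theorem stmt_17 {V : Type*} [Fintype V] [DecidableEq V]
    (G : SimpleGraph V) [DecidableRel G.Adj] (δ g : ℕ)
    (hreg : G.IsRegularOfDegree δ) (hg3 : 3 ≤ g) (hgirth : G.egirth = (g : ℕ∞)) :
    ∀ ℓ : ℕ, ℓ ≤ 2 * ((g - 1) / 2) → ∀ u v : V,
      ((G.adjMatrix ℝ) ^ ℓ) u u = ((G.adjMatrix ℝ) ^ ℓ) v v := by
  intro l hl u v
  have h : ∀ u : V, ((G.adjMatrix ℝ) ^ l) u u = Stmt17.c δ l 0 := by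
    intro u
    have := Stmt17.main G δ g hreg hgirth.ge l u u (SimpleGraph.Reachable.refl u)
      (by rw [SimpleGraph.dist_self]; omega)
    rwa [SimpleGraph.dist_self] at this
  rw [h u, h v]
end

section
/- Let G be a connected δ-regular graph on n vertices whose adjacency matrix A has exactly three distinct eigenvalues δ > θ > τ with multiplicities 1, m_θ, m_τ (so G is strongly regular). If θ ≠ 0 then, for every integer m ≥ 1, α(G^{⊠m}) ≤ (1 + m_τ)^m, and if τ ≠ 0 then, for every integer m ≥ 1, α(G^{⊠m}) ≤ (1 + m_θ)^m; in particular the Shannon capacity of G is at most min{1 + m_θ, 1 + m_τ} whenever θ, τ ≠ 0. -/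
open Polynomial

lemma haemers_aux {V ι : Type*} [Fintype V] [DecidableEq V] [Fintype ι]
    (G : SimpleGraph V) (P : V → ι → ℝ) (Q : ι → V → ℝ)
    (hd : ∀ v, ∑ i, P v i * Q i v ≠ 0)
    (ho : ∀ u v, u ≠ v → ¬ G.Adj u v → ∑ i, P u i * Q i v = 0) (m : ℕ) :
    indepNum (strongPower G m) ≤ Fintype.card ι ^ m := by
  classical
  unfold indepNum
  refine csSup_le' ?_
  rintro _ ⟨s, rfl, hs⟩
  let P' : Matrix s (Fin m → ι) ℝ := fun u f => ∏ j, P (u.1 j) (f j)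
  let Q' : Matrix (Fin m → ι) s ℝ := fun f v => ∏ j, Q (f j) (v.1 j)
  have hmul : ∀ u v : s, (P' * Q') u v = ∏ j, ∑ i, P (u.1 j) i * Q i (v.1 j) := by
    intro u v
    rw [Matrix.mul_apply, Finset.prod_univ_sum, Fintype.piFinset_univ]
    simp [P', Q', Finset.prod_mul_distrib]
  have hdiag : P' * Q' = Matrix.diagonal (fun u : s => ∏ j, ∑ i, P (u.1 j) i * Q i (u.1 j)) := by
    ext u v
    by_cases huv : u = v
    · subst huv
      rw [hmul, Matrix.diagonal_apply_eq]
    · rw [hmul, Matrix.diagonal_apply_ne _ huv]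
      have hne : u.1 ≠ v.1 := fun h => huv (Subtype.ext h)
      have h := hs u.1 u.2 v.1 v.2 hne
      have : ∃ j, ¬ (u.1 j = v.1 j ∨ G.Adj (u.1 j) (v.1 j)) := by
        by_contra hc
        push Not at hc
        exact h ((SimpleGraph.fromRel_adj _ _ _).2 ⟨hne, Or.inl hc⟩)
      obtain ⟨j, hj⟩ := this
      push Not at hj
      exact Finset.prod_eq_zero (Finset.mem_univ j) (ho _ _ hj.1 hj.2)
  have hr : (P' * Q').rank = s.card := by
    rw [hdiag, Matrix.rank_of_isUnit]
    · simp
    · rw [Matrix.isUnit_iff_isUnit_det, Matrix.det_diagonal, isUnit_iff_ne_zero]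
      exact Finset.prod_ne_zero_iff.2 fun u _ => Finset.prod_ne_zero_iff.2 fun j _ => hd _
  calc s.card = (P' * Q').rank := hr.symm
    _ ≤ P'.rank := Matrix.rank_mul_le_left _ _
    _ ≤ Fintype.card (Fin m → ι) := Matrix.rank_le_card_width _
    _ = _ := by simp

lemma haemers_eig {V : Type*} [Fintype V] [DecidableEq V]
    (G : SimpleGraph V) [DecidableRel G.Adj] (c d t : ℝ) (a b : ℕ) (hc : c ≠ 0)
    (hchar : (G.adjMatrix ℝ).charpoly = (X - C d) * (X - C c) ^ a * (X - C t) ^ b) (m : ℕ) :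
    indepNum (strongPower G m) ≤ (1 + b) ^ m := by
  classical
  have hA : (G.adjMatrix ℝ).IsHermitian := G.isHermitian_adjMatrix ℝ
  set U : Matrix V V ℝ := (hA.eigenvectorUnitary).1 with hU
  have hUU : U * star U = 1 := Unitary.coe_mul_star_self _
  have hsp : G.adjMatrix ℝ = U * Matrix.diagonal hA.eigenvalues * star U := by
    have := hA.spectral_theorem
    rw [Unitary.conjStarAlgAut_apply] at this
    exact this
  have key : ∀ u v, ∑ i : {i // hA.eigenvalues i ≠ c},
      (U u i * (hA.eigenvalues i - c)) * U v i = (G.adjMatrix ℝ - c • 1) u v := by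
    intro u v
    have h1 : G.adjMatrix ℝ - c • 1
        = U * Matrix.diagonal (fun i => hA.eigenvalues i - c) * star U := by
      have : Matrix.diagonal (fun i => hA.eigenvalues i - c)
          = Matrix.diagonal hA.eigenvalues - c • (1 : Matrix V V ℝ) := by
        rw [Matrix.smul_one_eq_diagonal, Matrix.diagonal_sub]
      rw [this, Matrix.mul_sub, Matrix.sub_mul, ← hsp]
      simp [hUU]
    rw [h1, Matrix.mul_apply]
    simp only [Matrix.mul_diagonal, Matrix.star_apply, star_trivial]
    rw [← Finset.sum_subtype (Finset.univ.filter fun i => hA.eigenvalues i ≠ c) (by simp)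
      (fun i => U u i * (hA.eigenvalues i - c) * U v i)]
    rw [Finset.sum_filter]
    refine Finset.sum_congr rfl fun i _ => ?_
    by_cases h : hA.eigenvalues i = c <;> simp [h]
  have hcard : Fintype.card {i // hA.eigenvalues i ≠ c} ≤ 1 + b := by
    have h1 := hA.roots_charpoly_eq_eigenvalues
    have h2 : (G.adjMatrix ℝ).charpoly.roots = {d} + a • {c} + b • {t} := by
      have hd := X_sub_C_ne_zero d
      have hc' := pow_ne_zero a (X_sub_C_ne_zero c)
      have ht := pow_ne_zero b (X_sub_C_ne_zero t)
      rw [hchar, roots_mul (mul_ne_zero (mul_ne_zero hd hc') ht), roots_mul (mul_ne_zero hd hc'),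
        roots_pow, roots_pow, roots_X_sub_C, roots_X_sub_C, roots_X_sub_C]
    rw [h2] at h1
    have h3 := congrArg (Multiset.countP (fun x => x ≠ c)) h1
    rw [Multiset.countP_map] at h3
    have h4 : Fintype.card {i // hA.eigenvalues i ≠ c} =
        Multiset.countP (fun x => x ≠ c) ({d} + a • {c} + b • {t}) := by
      rw [h3, Fintype.card_subtype]
      rfl
    rw [h4, Multiset.countP_add, Multiset.countP_add, Multiset.countP_nsmul,
      Multiset.countP_nsmul]
    have e1 : Multiset.countP (fun x => x ≠ c) {d} ≤ 1 := Multiset.countP_le_card _ _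
    have e2 : Multiset.countP (fun x => x ≠ c) {c} = 0 := by
      rw [Multiset.countP_eq_zero]; simp
    have e3 : Multiset.countP (fun x => x ≠ c) {t} ≤ 1 := Multiset.countP_le_card _ _
    rw [e2]
    nlinarith
  refine (haemers_aux G (ι := {i // hA.eigenvalues i ≠ c})
    (fun u i => U u i * (hA.eigenvalues i - c)) (fun i v => U v i) ?_ ?_ m).trans
    (Nat.pow_le_pow_left hcard m)
  · intro v
    rw [key]
    simp [hc]
  · intro u v huv hadj
    rw [key]
    simp [huv, hadj]

lemma capacity_aux {V : Type*} [Fintype V] (G : SimpleGraph V) (b : ℕ)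
    (h : ∀ m : ℕ, 1 ≤ m → indepNum (strongPower G m) ≤ (1 + b) ^ m) :
    shannonCapacity G ≤ 1 + (b : ℝ) := by
  refine ciSup_le fun m => ?_
  have hm : ((m : ℕ) : ℝ) ≠ 0 := by exact_mod_cast m.ne_zero
  rw [Real.rpow_inv_le_iff_of_pos (by positivity) (by positivity)
    (by exact_mod_cast m.pos), Real.rpow_natCast]
  exact_mod_cast h m m.one_le

theorem stmt_18 {V : Type*} [Fintype V] [DecidableEq V]
    (G : SimpleGraph V) [DecidableRel G.Adj]
    (hconn : G.Connected) (n δ : ℕ) (hn : Fintype.card V = n)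
    (hreg : G.IsRegularOfDegree δ)
    (θ τ : ℝ) (mθ mτ : ℕ) (hδθ : θ < (δ : ℝ)) (hθτ : τ < θ)
    (hmθ : 1 ≤ mθ) (hmτ : 1 ≤ mτ)
    (hchar : (G.adjMatrix ℝ).charpoly =
      (X - C ((δ : ℕ) : ℝ)) * (X - C θ) ^ mθ * (X - C τ) ^ mτ) :
    (θ ≠ 0 → ∀ m : ℕ, 1 ≤ m → indepNum (strongPower G m) ≤ (1 + mτ) ^ m) ∧
    (τ ≠ 0 → ∀ m : ℕ, 1 ≤ m → indepNum (strongPower G m) ≤ (1 + mθ) ^ m) ∧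
    (θ ≠ 0 → τ ≠ 0 →
      shannonCapacity G ≤ min ((1 : ℝ) + (mθ : ℝ)) ((1 : ℝ) + (mτ : ℝ))) := by
  have H1 : θ ≠ 0 → ∀ m : ℕ, 1 ≤ m → indepNum (strongPower G m) ≤ (1 + mτ) ^ m :=
    fun h m _ => haemers_eig G θ δ τ mθ mτ h hchar m
  have H2 : τ ≠ 0 → ∀ m : ℕ, 1 ≤ m → indepNum (strongPower G m) ≤ (1 + mθ) ^ m :=
    fun h m _ => haemers_eig G τ δ θ mτ mθ h (by rw [hchar]; ring) m
  exact ⟨H1, H2, fun h1 h2 => le_min (capacity_aux G mθ (H2 h2)) (capacity_aux G mτ (H1 h1))⟩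
end
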